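/- arXiv:2401.03982 — 2 statements merged into one kernel-verified Lean document; each statement's English description precedes it below -/
import Mathlib

section
/- Let n ≥ 2 be an integer. There is a constant c = c(n) such that the following holds for every field F (of any characteristic). Let f ∈ F[x₀,…,x_n] be a nonzero homogeneous polynomial of degree D and let k ≥ 1 be a real number. Then there exists a nonzero homogeneous polynomial g ∈ F[x₀,…,x_n] with 1 ≤ deg g ≤ c·k^{2^{n−2}} that vanishes at every point P ∈ ℙⁿ(F) with f(P) = 0 and mult_P(f) > D/k. -/
open MvPolynomial

/-- The multiplicity of a polynomial `g` at a point `q`: the smallest total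
degree of a monomial occurring with nonzero coefficient in the translate
`g(q + y)`. -/
noncomputable def multAt {F : Type*} [CommRing F] {m : ℕ} (q : Fin m → F)
    (g : MvPolynomial (Fin m) F) : ℕ :=
  sInf {k : ℕ | ∃ s ∈ (MvPolynomial.aeval
      (fun i => MvPolynomial.C (q i) + MvPolynomial.X i) g).support,
    (s.sum fun _ e => e) = k}

section Translate

variable {σ R : Type*} [CommRing R]

/-- The algebra endomorphism `f(y) ↦ f(P + y)`. -/
noncomputable def shiftHom (P : σ → R) : MvPolynomial σ R →ₐ[R] MvPolynomial σ R :=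
  aeval fun i => C (P i) + X i

lemma shiftHom_X (P : σ → R) (i : σ) : shiftHom P (X i) = C (P i) + X i := by
  simp [shiftHom]

lemma shiftHom_neg_shiftHom (P : σ → R) (f : MvPolynomial σ R) :
    shiftHom (-P) (shiftHom P f) = f := by
  have : (shiftHom (-P)).comp (shiftHom P) = AlgHom.id R _ := by
    ext1 i
    simp [shiftHom]
  exact DFunLike.congr_fun this f

lemma map_shiftHom {S : Type*} [CommRing S] (φ : R →+* S) (P : σ → R) (f : MvPolynomial σ R) :
    map φ (shiftHom P f) = shiftHom (fun i => φ (P i)) (map φ f) := by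
  induction f using MvPolynomial.induction_on with
  | C a => simp [shiftHom, algebraMap_eq]
  | add f g hf hg => simp [hf, hg]
  | mul_X f i hf => simp [hf, shiftHom_X]

lemma idealOfVars_pow_card_mul_le [Fintype σ] [Nonempty σ] (q : ℕ) :
    idealOfVars σ R ^ (Fintype.card σ * q) ≤
      Ideal.span (Set.range fun i : σ => (X i : MvPolynomial σ R) ^ q) := by
  intro f hf
  rw [mem_pow_idealOfVars_iff] at hf
  rw [f.as_sum]
  refine Ideal.sum_mem _ fun s hs => ?_
  obtain ⟨i, hi⟩ : ∃ i, q ≤ s i := by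
    by_contra! h
    have h1 := hf s hs
    have h2 : ∑ i, s i < ∑ _i : σ, q :=
      Finset.sum_lt_sum_of_nonempty Finset.univ_nonempty fun i _ => h i
    rw [Finsupp.degree_eq_sum] at h1
    simp at h2
    omega
  have h3 : monomial s (coeff s f) =
      monomial (s - Finsupp.single i q) (coeff s f) * X i ^ q := by
    rw [X_pow_eq_monomial, monomial_mul, mul_one, tsub_add_cancel_of_le (by simpa using hi)]
  rw [h3]
  exact Ideal.mul_mem_left _ _ (Ideal.subset_span ⟨i, rfl⟩)

lemma mem_span_of_shiftHom_mem [Fintype σ] [Nonempty σ] (p : ℕ) [Fact p.Prime] [CharP R p]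
    (r : ℕ) (P : σ → R) (f : MvPolynomial σ R)
    (hf : shiftHom P f ∈ idealOfVars σ R ^ (Fintype.card σ * p ^ r)) :
    f ∈ Ideal.span (Set.range fun i : σ =>
      (X i : MvPolynomial σ R) ^ p ^ r - C (P i ^ p ^ r)) := by
  have h1 : Ideal.span (Set.range fun i : σ => (X i : MvPolynomial σ R) ^ p ^ r) ≤
      Ideal.comap (shiftHom (-P)) (Ideal.span (Set.range fun i : σ =>
        (X i : MvPolynomial σ R) ^ p ^ r - C (P i ^ p ^ r))) := by
    rw [Ideal.span_le]
    rintro _ ⟨i, rfl⟩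
    refine Ideal.subset_span ⟨i, ?_⟩
    simp only [map_pow, shiftHom_X, Pi.neg_apply, map_neg]
    rw [neg_add_eq_sub, sub_pow_char_pow]
  have h2 := h1 (idealOfVars_pow_card_mul_le _ hf)
  rwa [Ideal.mem_comap, shiftHom_neg_shiftHom] at h2

end Translate

section Extract

variable {σ R : Type*} [CommRing R]

open Classical in
/-- The polynomial `h` in the component `x ^ α * h(x ^ q)` of `f` consisting of the monomials
whose exponents are congruent to `α` modulo `q`. -/
noncomputable def expComponent (q : ℕ) (α : σ →₀ ℕ) : MvPolynomial σ R →ₗ[R] MvPolynomial σ R :=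
  (basisMonomials σ R).constr R fun s =>
    if ∀ i, s i % q = α i then monomial (s.mapRange (· / q) (Nat.zero_div q)) 1 else 0

open Classical in
lemma expComponent_monomial (q : ℕ) (α s : σ →₀ ℕ) (c : R) :
    expComponent q α (monomial s c) =
      if ∀ i, s i % q = α i then monomial (s.mapRange (· / q) (Nat.zero_div q)) c else 0 := by
  have h1 : monomial s c = c • basisMonomials σ R s := by
    simp [coe_basisMonomials, smul_monomial]
  rw [h1, map_smul, expComponent, Module.Basis.constr_basis]
  split_ifs <;> simp [smul_monomial]

lemma coeff_expComponent {q : ℕ} {α : σ →₀ ℕ} (hα : ∀ i, α i < q) (β : σ →₀ ℕ)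
    (f : MvPolynomial σ R) : coeff β (expComponent q α f) = coeff (q • β + α) f := by
  classical
  induction f using MvPolynomial.induction_on' with
  | add f g hf hg => simp [hf, hg]
  | monomial s c =>
    rw [expComponent_monomial, coeff_monomial]
    by_cases h : s = q • β + α
    · subst h
      rw [if_pos rfl, if_pos, coeff_monomial, if_pos]
      · ext i
        have := hα i
        simp [Nat.mul_add_div (Nat.zero_lt_of_lt this), Nat.div_eq_of_lt this]
      · intro i
        simp [Nat.mod_eq_of_lt (hα i)]
    · rw [if_neg h]
      split_ifs with h1
      · rw [coeff_monomial, if_neg]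
        rintro rfl
        apply h
        ext i
        simp [← h1 i, Nat.div_add_mod]
      · simp

lemma expComponent_X_pow_mul {q : ℕ} {α : σ →₀ ℕ} (hα : ∀ i, α i < q) (i : σ)
    (f : MvPolynomial σ R) : expComponent q α (X i ^ q * f) = X i * expComponent q α f := by
  classical
  have hq : 0 < q := Nat.zero_lt_of_lt (hα i)
  induction f using MvPolynomial.induction_on' with
  | add f g hf hg => simp [mul_add, hf, hg]
  | monomial s c =>
    rw [X_pow_eq_monomial, monomial_mul, one_mul, expComponent_monomial, expComponent_monomial]
    have h1 : ∀ j, (Finsupp.single i q + s) j % q = s j % q := by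
      intro j
      by_cases h : i = j
      · subst h; simp
      · simp [h]
    simp only [h1]
    split_ifs
    · rw [X, monomial_mul, one_mul]
      refine congrArg (monomial · c) (Finsupp.ext fun j => ?_)
      by_cases h : i = j
      · subst h; simp [Nat.add_div_left _ hq, add_comm]
      · simp [h]
    · simp

lemma eval_expComponent_eq_zero [Fintype σ] [Nonempty σ] (p : ℕ) [Fact p.Prime] [CharP R p]
    {r : ℕ} {α : σ →₀ ℕ} (hα : ∀ i, α i < p ^ r) (P : σ → R) (f : MvPolynomial σ R)
    (hf : shiftHom P f ∈ idealOfVars σ R ^ (Fintype.card σ * p ^ r)) :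
    eval (fun i => P i ^ p ^ r) (expComponent (p ^ r) α f) = 0 := by
  obtain ⟨c, rfl⟩ := (Ideal.mem_span_range_iff_exists_fun).1 (mem_span_of_shiftHom_mem p r P f hf)
  simp only [map_sum]
  refine Finset.sum_eq_zero fun i _ => ?_
  rw [mul_comm, sub_mul, map_sub, expComponent_X_pow_mul hα, C_mul', map_smul, map_sub, smul_eval]
  simp

lemma MvPolynomial.IsHomogeneous.exists_expComponent {f : MvPolynomial σ R} {D : ℕ}
    (hf : f.IsHomogeneous D) (hf0 : f ≠ 0) {q : ℕ} (hq : 0 < q) :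
    ∃ α : σ →₀ ℕ, (∀ i, α i < q) ∧ expComponent q α f ≠ 0 ∧
      ∃ e, q * e ≤ D ∧ (expComponent q α f).IsHomogeneous e := by
  obtain ⟨s, hs⟩ := ne_zero_iff.1 hf0
  set α : σ →₀ ℕ := s.mapRange (· % q) (Nat.zero_mod q)
  set β : σ →₀ ℕ := s.mapRange (· / q) (Nat.zero_div q)
  have hα : ∀ i, α i < q := fun i => by simpa [α] using Nat.mod_lt _ hq
  have hsβ : q • β + α = s := by
    ext i
    simp [α, β, Nat.div_add_mod]
  have hdeg : ∀ γ : σ →₀ ℕ, coeff (q • γ + α) f ≠ 0 → q * γ.degree + α.degree = D := by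
    intro γ h
    have := hf h
    rw [Pi.one_def, ← Finsupp.degree_eq_weight_one] at this
    simpa using this
  refine ⟨α, hα, ?_, β.degree, ?_, ?_⟩
  · rw [ne_zero_iff]
    exact ⟨β, by rwa [coeff_expComponent hα, hsβ]⟩
  · have := hdeg β (by rwa [hsβ])
    omega
  · intro γ h
    rw [coeff_expComponent hα] at h
    have h1 := hdeg γ h
    have h2 := hdeg β (by rwa [hsβ])
    rw [Pi.one_def, ← Finsupp.degree_eq_weight_one]
    exact Nat.eq_of_mul_eq_mul_left hq (by change q * γ.degree = _; omega)

end Extract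

lemma LinearIndependent.exists_det_ne_zero {B S F : Type*} [Fintype B] [DecidableEq B] [Field F]
    {w : B → S → F} (h : LinearIndependent F w) :
    ∃ a : B → S, (Matrix.of fun b b' => w b (a b')).det ≠ 0 := by
  have h1 := span_flip_eq_top_iff_linearIndependent.2 h
  obtain ⟨κ, a, -, hspan, hli⟩ := exists_linearIndependent' F (flip w)
  let bas := Module.Basis.mk hli (hspan.trans h1).ge
  let e : B ≃ κ := (Pi.basisFun F B).indexEquiv bas
  refine ⟨a ∘ e, ?_⟩
  have h2 : LinearIndependent F (Matrix.of fun b b' => w b ((a ∘ e) b')).col :=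
    hli.comp e e.injective
  rw [Matrix.linearIndependent_cols_iff_isUnit, Matrix.isUnit_iff_isUnit_det] at h2
  exact h2.ne_zero

lemma Int.isJacobsonRing : IsJacobsonRing ℤ := by
  rw [isJacobsonRing_iff_prime_eq]
  intro P hP
  by_cases h : P = ⊥
  · subst h
    refine le_antisymm (fun x hx => ?_) Ideal.le_jacobson
    have h1 := Int.isUnit_iff.1 (Ideal.mem_jacobson_bot.1 hx x)
    have h2 : x * x = 0 := by
      have := mul_self_nonneg x
      omega
    exact mul_self_eq_zero.1 h2
  · have := hP.isMaximal h
    exact Ideal.jacobson_eq_self_of_isMaximal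

lemma exists_charP_of_finiteType_int (K : Type*) [Field K] (h : (Int.castRingHom K).FiniteType) :
    ∃ p : ℕ, Fact p.Prime ∧ CharP K p := by
  have := Int.isJacobsonRing
  have : Algebra.FiniteType ℤ K := by
    rw [← RingHom.finiteType_algebraMap]
    exact h
  have hfin : Module.Finite ℤ K := finite_of_finite_type_of_isJacobsonRing _ _
  obtain ⟨p, hp⟩ := CharP.exists K
  have hp0 : p ≠ 0 := by
    rintro rfl
    have := CharP.charP_to_charZero K
    exact Int.not_isField (isField_of_isIntegral_of_isField
      (algebraMap ℤ K).injective_int (Field.toIsField K))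
  exact ⟨p, ⟨(CharP.char_is_prime_or_zero K p).resolve_right hp0⟩, hp⟩

universe u in
lemma exists_charP_ringHom_ne_zero {A : Type u} [CommRing A] [IsDomain A] [Algebra.FiniteType ℤ A]
    {s : A} (hs : s ≠ 0) :
    ∃ (K : Type u) (_ : Field K) (p : ℕ) (_ : Fact p.Prime) (_ : CharP K p) (φ : A →+* K),
      φ s ≠ 0 := by
  have hnt : Nontrivial (Localization.Away s) :=
    (IsLocalization.injective (Localization.Away s) (M := Submonoid.powers s)
      (powers_le_nonZeroDivisors_of_noZeroDivisors hs)).nontrivial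
  obtain ⟨M, hM⟩ := Ideal.exists_maximal (Localization.Away s)
  have hft : (Int.castRingHom (Localization.Away s ⧸ M)).FiniteType := by
    have h1 : (algebraMap ℤ A).FiniteType := RingHom.finiteType_algebraMap.2 inferInstance
    have h2 : (algebraMap A (Localization.Away s)).FiniteType :=
      RingHom.finiteType_algebraMap.2 inferInstance
    convert (RingHom.FiniteType.of_surjective _ (Ideal.Quotient.mk_surjective (I := M))).comp
      (h2.comp h1)
    exact Subsingleton.elim _ _
  let : Field (Localization.Away s ⧸ M) := Ideal.Quotient.field M
  obtain ⟨p, hp, hpc⟩ := exists_charP_of_finiteType_int (Localization.Away s ⧸ M) hft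
  refine ⟨_, inferInstance, p, hp, hpc, (Ideal.Quotient.mk M).comp (algebraMap A _), ?_⟩
  exact ((IsLocalization.Away.algebraMap_isUnit s).map (Ideal.Quotient.mk M)).ne_zero

lemma Finsupp.finite_setOf_degree_eq (σ : Type*) [Finite σ] (E : ℕ) :
    {b : σ →₀ ℕ | b.degree = E}.Finite := by
  classical
  have := Fintype.ofFinite σ
  refine (Finset.finite_toSet (Finset.finsuppAntidiag Finset.univ E)).subset fun b hb => ?_
  simpa [Finset.mem_finsuppAntidiag, Finsupp.degree_eq_sum] using hb

section Interpolation

variable {σ F : Type*} [Fintype σ] [Field F]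

/-- If no nonzero form of degree `E` vanishes on `S`, then some points of `S`, as many as there are
monomials of degree `E`, have nonzero interpolation determinant. -/
lemma exists_interpolation_det_ne_zero (S : Set (σ → F)) (E : ℕ) {B : Type*} [Fintype B]
    [DecidableEq B] (m : B → σ →₀ ℕ) (hm : Function.Injective m) (hE : ∀ b, (m b).degree = E)
    (hS : ∀ g : MvPolynomial σ F, g.IsHomogeneous E → (∀ P ∈ S, eval P g = 0) → g = 0) :
    ∃ a : B → S, (Matrix.of fun b b' => ∏ i, (a b' : σ → F) i ^ m b i).det ≠ 0 := by
  refine LinearIndependent.exists_det_ne_zero (w := fun b (P : S) => ∏ i, (P : σ → F) i ^ m b i)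
    (Fintype.linearIndependent_iff.2 fun c hc b => ?_)
  have h1 : ∑ b, monomial (m b) (c b) = 0 := by
    refine hS _ (.sum _ _ _ fun b _ => isHomogeneous_monomial _ (hE b)) fun P hP => ?_
    simpa [eval_monomial, Finsupp.prod_fintype] using congrFun hc ⟨P, hP⟩
  classical
  have h2 := congrArg (coeff (m b)) h1
  rw [coeff_sum, Finset.sum_eq_single b (fun b' _ hb => by
    rw [coeff_monomial, if_neg (hm.ne hb)]) (by simp), coeff_monomial, if_pos rfl] at h2
  exact h2

lemma eq_zero_of_interpolation_det_ne_zero (E : ℕ) {B : Type*} [Fintype B] [DecidableEq B]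
    (m : B → σ →₀ ℕ) (hm : Function.Injective m) (hE : ∀ s, s.degree = E → s ∈ Set.range m)
    (P : B → σ → F) (hdet : (Matrix.of fun b b' => ∏ i, P b' i ^ m b i).det ≠ 0)
    {g : MvPolynomial σ F} (hg : g.IsHomogeneous E) (h : ∀ b, eval (P b) g = 0) : g = 0 := by
  have hsupp : ∀ s, coeff s g ≠ 0 → s ∈ Set.range m := fun s hs => hE s <| by
    simpa [Pi.one_def, ← Finsupp.degree_eq_weight_one] using hg hs
  have hv : Matrix.vecMul (fun b => coeff (m b) g)
      (Matrix.of fun b b' => ∏ i, P b' i ^ m b i) = 0 := by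
    ext b'
    rw [Pi.zero_apply, ← h b', eval_eq', Finset.sum_subset (s₂ := Finset.univ.image m)
      (fun s hs => by simpa using hsupp s (mem_support_iff.1 hs))
      (fun s _ hs => by rw [notMem_support_iff.1 hs, zero_mul]),
      Finset.sum_image hm.injOn]
    rfl
  have h0 := Matrix.eq_zero_of_vecMul_eq_zero hdet hv
  ext s
  by_contra hs
  obtain ⟨b, rfl⟩ := hsupp s hs
  exact hs (congrFun h0 b)

end Interpolation

section Reduction

variable {σ : Type*} [Fintype σ] [Nonempty σ]

/-- Positive characteristic case: write a power of `f` as `∑ α, x ^ α * h_α(x ^ q)`;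
the `h_α` vanish at the Frobenius images of the points where `f` has large multiplicity. -/
lemma exists_form_vanishing_frobenius {K : Type*} [Field K] (p : ℕ) [Fact p.Prime] [CharP K p]
    {f : MvPolynomial σ K} {D : ℕ} (hf0 : f ≠ 0) (hf : f.IsHomogeneous D) {m E : ℕ} (hm : 0 < m)
    (hE : Fintype.card σ * D ≤ E * m) :
    ∃ g : MvPolynomial σ K, g ≠ 0 ∧ g.IsHomogeneous (E + 1) ∧ ∃ r : ℕ, ∀ P : σ → K,
      shiftHom P f ∈ idealOfVars σ K ^ m → eval (fun i => P i ^ p ^ r) g = 0 := by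
  obtain ⟨i₀⟩ := ‹Nonempty σ›
  set N := Fintype.card σ
  have hp : 1 < p := (Fact.out : p.Prime).one_lt
  have hqD : D ≤ p ^ D := (Nat.lt_pow_self hp).le
  have hq0 : 0 < p ^ D := by positivity
  set q := p ^ D with hq
  set a := N * q / m + 1
  have ham : N * q ≤ m * a := (Nat.lt_mul_div_succ _ hm).le
  have haD : D * a ≤ q * (E + 1) := by
    have h1 : N * q / m * m ≤ N * q := Nat.div_mul_le_self _ _
    have h2 : m * (D * (N * q / m)) ≤ m * (q * E) := by
      calc m * (D * (N * q / m)) = N * q / m * m * D := by ring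
        _ ≤ N * q * D := by gcongr
        _ = q * (N * D) := by ring
        _ ≤ q * (E * m) := by gcongr
        _ = m * (q * E) := by ring
    have h3 := Nat.le_of_mul_le_mul_left h2 hm
    simp only [a, mul_add, mul_one]
    omega
  obtain ⟨α, hα, hne, e, hqe, hhom⟩ := (hf.pow a).exists_expComponent (pow_ne_zero a hf0) hq0
  have heE : e ≤ E + 1 := Nat.le_of_mul_le_mul_left (hqe.trans haD) hq0
  refine ⟨X i₀ ^ (E + 1 - e) * expComponent q α (f ^ a), mul_ne_zero (by simp) hne, ?_, D,
    fun P hP => ?_⟩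
  · have := (isHomogeneous_X_pow (R := K) i₀ (E + 1 - e)).mul hhom
    rwa [Nat.sub_add_cancel heE] at this
  · rw [map_mul, eval_expComponent_eq_zero p hα, mul_zero]
    have h1 := Ideal.pow_mem_pow hP a
    rw [← pow_mul, ← map_pow] at h1
    exact Ideal.pow_le_pow_right ham h1

theorem exists_form_vanishing {F : Type*} [Field F] (S : Set (σ → F))
    {f : MvPolynomial σ F} {D : ℕ} (hf0 : f ≠ 0) (hf : f.IsHomogeneous D) {m E : ℕ} (hm : 0 < m)
    (hE : Fintype.card σ * D ≤ E * m) (hS : ∀ P ∈ S, shiftHom P f ∈ idealOfVars σ F ^ m) :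
    ∃ g : MvPolynomial σ F, g ≠ 0 ∧ g.IsHomogeneous (E + 1) ∧ ∀ P ∈ S, eval P g = 0 := by
  classical
  by_contra! hcon
  have := (Finsupp.finite_setOf_degree_eq σ (E + 1)).fintype
  obtain ⟨pt, hdet⟩ := exists_interpolation_det_ne_zero S (E + 1)
    (fun b : {b : σ →₀ ℕ | b.degree = E + 1} => b.1) Subtype.val_injective (fun b => b.2)
    fun g hg h => by
      by_contra hg0
      obtain ⟨P, hP, hne⟩ := hcon g hg0 hg
      exact hne (h P hP)
  set T : Set F := f.coeffs ∪ Set.range fun x : {b : σ →₀ ℕ | b.degree = E + 1} × σ =>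
    (pt x.1 : σ → F) x.2
  have hT : T.Finite := (Finset.finite_toSet _).union (Set.finite_range _)
  set A := Algebra.adjoin ℤ T
  have hA : Algebra.FiniteType ℤ A := .adjoin_of_finite hT
  let ι : A →+* F := A.val.toRingHom
  have hι : Function.Injective ι := Subtype.val_injective
  obtain ⟨f', hff'⟩ : f ∈ Set.range (map ι) := by
    rw [mem_range_map_iff_coeffs_subset]
    exact fun x hx => ⟨⟨x, Algebra.subset_adjoin (.inl hx)⟩, rfl⟩
  let P' : {b : σ →₀ ℕ | b.degree = E + 1} → σ → A := fun b i =>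
    ⟨(pt b : σ → F) i, Algebra.subset_adjoin (.inr ⟨(b, i), rfl⟩)⟩
  have hP' : ∀ b, shiftHom (P' b) f' ∈ idealOfVars σ A ^ m := by
    intro b
    have h1 := hS _ (pt b).2
    rw [mem_pow_idealOfVars_iff'] at h1 ⊢
    intro s hs
    have h2 := h1 s hs
    change coeff s (shiftHom (fun i => ι (P' b i)) f) = 0 at h2
    rw [← hff', ← map_shiftHom, coeff_map] at h2
    exact (map_eq_zero_iff ι hι).1 h2
  set M : Matrix {b : σ →₀ ℕ | b.degree = E + 1} {b : σ →₀ ℕ | b.degree = E + 1} A :=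
    Matrix.of fun b b' => ∏ i, P' b' i ^ b.1 i
  have hM : M.det ≠ 0 := by
    intro h
    apply hdet
    have h1 := congrArg ι h
    rw [RingHom.map_det, map_zero] at h1
    rw [← h1]
    congr 1
    ext b b'
    simp [M, P', ι]
  obtain ⟨s, hs⟩ := ne_zero_iff.1 hf0
  have hs' : coeff s f' ≠ 0 := fun h => hs (by rw [← hff', coeff_map, h, map_zero])
  obtain ⟨K, _, p, _, _, φ, hφ⟩ := exists_charP_ringHom_ne_zero (mul_ne_zero hs' hM)
  rw [map_mul] at hφ
  have hf' : f'.IsHomogeneous D := .of_map hι (hff' ▸ hf)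
  obtain ⟨g, hg0, hg, r, hgP⟩ := exists_form_vanishing_frobenius p (f := map φ f') (D := D)
    (ne_zero_iff.2 ⟨s, by rw [coeff_map]; exact left_ne_zero_of_mul hφ⟩) (hf'.map φ) hm hE
  refine hg0 (eq_zero_of_interpolation_det_ne_zero (E + 1)
    (fun b : {b : σ →₀ ℕ | b.degree = E + 1} => b.1) Subtype.val_injective
    (fun s hs => ⟨⟨s, hs⟩, rfl⟩) (fun b i => φ (P' b i) ^ p ^ r) ?_ hg fun b => hgP _ ?_)
  · have h1 : iterateFrobenius K p r (φ M.det) ≠ 0 := by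
      rw [iterateFrobenius_def]
      exact pow_ne_zero _ (right_ne_zero_of_mul hφ)
    rw [RingHom.map_det, RingHom.map_det] at h1
    convert h1 using 2
    ext b b'
    simp [M, iterateFrobenius_def, ← pow_mul, mul_comm]
  · rw [← map_shiftHom, mem_pow_idealOfVars_iff']
    intro s hs
    rw [coeff_map, (mem_pow_idealOfVars_iff' _ _).1 (hP' b) s hs, map_zero]

end Reduction

lemma shiftHom_mem_of_le_multAt {F : Type*} [Field F] {n m : ℕ} (P : Fin n → F)
    (f : MvPolynomial (Fin n) F) (h : m ≤ multAt P f) :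
    shiftHom P f ∈ idealOfVars (Fin n) F ^ m := by
  rw [mem_pow_idealOfVars_iff]
  exact fun s hs => h.trans (Nat.sInf_le ⟨s, hs, rfl⟩)

/-- Let `n ≥ 2`.  There is a constant `c = c(n)` such that for every field `F`,
every nonzero homogeneous `f ∈ F[x₀,…,x_n]` of degree `D` and every real
`k ≥ 1`, there is a nonzero homogeneous `g ∈ F[x₀,…,x_n]` of degree `e` with
`1 ≤ e ≤ c·k^(2^(n−2))` vanishing at every point `P ∈ ℙⁿ(F)` with `f(P) = 0`
and `mult_P(f) > D/k`. -/
theorem statement8 (n : ℕ) (hn : 2 ≤ n) :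
    ∃ c : ℝ, ∀ (F : Type*) [Field F], ∀ (D : ℕ),
      ∀ f : MvPolynomial (Fin (n + 1)) F, f ≠ 0 → f.IsHomogeneous D →
      ∀ k : ℝ, 1 ≤ k →
      ∃ g : MvPolynomial (Fin (n + 1)) F, g ≠ 0 ∧
        ∃ e : ℕ, g.IsHomogeneous e ∧ 1 ≤ e ∧ (e : ℝ) ≤ c * k ^ (2 ^ (n - 2)) ∧
          ∀ P : Projectivization F (Fin (n + 1) → F),
            eval P.rep f = 0 → (D : ℝ) / k < (multAt P.rep f : ℝ) →
            eval P.rep g = 0 := by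
  refine ⟨n + 3, fun F _ D f hf0 hf k hk => ?_⟩
  have hk0 : 0 < k := by positivity
  set m := ⌊(D : ℝ) / k⌋₊ + 1 with hm
  have hDm : (D : ℝ) ≤ k * m := by
    have := (Nat.lt_floor_add_one ((D : ℝ) / k)).le
    rw [div_le_iff₀ hk0] at this
    rw [hm]
    push_cast
    linarith
  have hE : Fintype.card (Fin (n + 1)) * D ≤ ⌈(n + 1) * k⌉₊ * m := by
    rify
    rw [Fintype.card_fin]
    push_cast
    calc ((n : ℝ) + 1) * D ≤ (n + 1) * (k * m) := by gcongr
      _ = (n + 1) * k * m := by ring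
      _ ≤ ⌈((n : ℝ) + 1) * k⌉₊ * m := by gcongr; exact Nat.le_ceil _
  obtain ⟨g, hg0, hg, hgP⟩ := exists_form_vanishing
    {P | shiftHom P f ∈ idealOfVars (Fin (n + 1)) F ^ m} hf0 hf (Nat.succ_pos _) hE fun _ h => h
  refine ⟨g, hg0, _, hg, Nat.le_add_left _ _, ?_, fun P _ hP => hgP _ ?_⟩
  · have h1 := (Nat.ceil_lt_add_one (a := ((n : ℝ) + 1) * k) (by positivity)).le
    push_cast
    calc (⌈((n : ℝ) + 1) * k⌉₊ : ℝ) + 1 ≤ (n + 3) * k := by linarith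
      _ ≤ (n + 3) * k ^ (2 ^ (n - 2)) := by
        gcongr
        exact le_self_pow₀ hk (by positivity)
  · exact shiftHom_mem_of_le_multAt _ _ ((Nat.floor_lt (by positivity)).2 hP)
end

section
/- There exist absolute constants c and H₀ such that the following holds. Let H ≥ H₀ be a real number and let d be an integer with (log H)² < d < H^{3/2}. Let f ∈ ℚ[x₀,x₁,x₂] be an irreducible homogeneous polynomial of degree d defining the plane curve C ⊆ ℙ²_ℚ. Then there exist nonzero homogeneous polynomials g₁, …, g_r ∈ ℚ[x₀,x₁,x₂], each of degree d−1, with r ≤ c·(log H)^{12}, such that every point of C(ℚ,H) lies in the zero locus of at least one g_i. -/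
open MvPolynomial

/-- `x ∈ ℙⁿ(ℚ)` has height at most `H`: it has primitive integer homogeneous
coordinates `y` with `max_i |y_i| ≤ H`. -/
def qHeightLe {n : ℕ} (x : Projectivization ℚ (Fin n → ℚ)) (H : ℝ) : Prop :=
  ∃ y : Fin n → ℤ,
    (∃ hy : (fun i => (y i : ℚ)) ≠ 0, Projectivization.mk ℚ (fun i => (y i : ℚ)) hy = x) ∧
    Finset.univ.gcd y = 1 ∧ ∀ i, |(y i : ℝ)| ≤ H

/-- Divisibility of a determinant whose rows are, class by class and modulo `π ^ k`, combinations of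
vectors weighted by powers of `π`. -/
lemma pow_dvd_det_of_rows {ι β κ R : Type*} [Fintype ι] [DecidableEq ι] [CommRing R]
    (π : R) {k r B G : ℕ} (A : Matrix ι ι R) (cls : ι → κ) (J : κ → Finset β) (w : β → ℕ)
    (c : ι → β → R) (W : κ → β → ι → R) (V : ι → ι → R)
    (hA : ∀ i j, A i j = ∑ b ∈ J (cls i), π ^ w b * c i b * W (cls i) b j + π ^ k * V i j)
    (S : Finset κ) (hS : ∀ i, cls i ∈ S) (hB : ∀ s ∈ S, ∑ b ∈ J s, (r - w b) ≤ B)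
    (hGk : G ≤ k) (hG : G + S.card * B ≤ r * Fintype.card ι) : π ^ G ∣ A.det := by
  classical
  set A' : Matrix ι ι R :=
    fun i => ∑ b ∈ J (cls i), (π ^ w b * c i b) • W (cls i) b with hA'
  have hred : π ^ k ∣ A.det - A'.det := by
    rw [← Ideal.mem_span_singleton, ← Ideal.Quotient.eq]
    rw [RingHom.map_det, RingHom.map_det]
    congr 1
    ext i j
    simp only [RingHom.mapMatrix_apply, Matrix.map_apply]
    rw [Ideal.Quotient.eq, Ideal.mem_span_singleton]
    refine ⟨V i j, ?_⟩
    rw [hA, hA']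
    simp [Finset.sum_apply]
  have hmain : π ^ G ∣ A'.det := by
    have hexp := (Matrix.detRowAlternating (n := ι) (R := R)).toMultilinearMap.map_sum_finset
      (fun i b => (π ^ w b * c i b) • W (cls i) b) (fun i => J (cls i))
    have hexp' : A'.det = ∑ φ ∈ Fintype.piFinset fun i => J (cls i),
        Matrix.det (fun i => (π ^ w (φ i) * c i (φ i)) • W (cls i) (φ i)) := hexp
    rw [hexp']
    refine Finset.dvd_sum fun φ hφ => ?_
    rw [Fintype.mem_piFinset] at hφ
    have hsm := (Matrix.detRowAlternating (n := ι) (R := R)).toMultilinearMap.map_smul_univ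
      (fun i => π ^ w (φ i) * c i (φ i)) (fun i => W (cls i) (φ i))
    have hsm' : Matrix.det (fun i => (π ^ w (φ i) * c i (φ i)) • W (cls i) (φ i)) =
      (∏ i, π ^ w (φ i) * c i (φ i)) * Matrix.det (fun i => W (cls i) (φ i)) := hsm
    rw [hsm']
    by_cases hinj : Function.Injective fun i => (⟨cls i, φ i⟩ : κ × β)
    · refine Dvd.dvd.mul_right ?_ _
      rw [Finset.prod_mul_distrib, Finset.prod_pow_eq_pow_sum]
      refine Dvd.dvd.mul_right (pow_dvd_pow _ ?_) _
      have h1 : ∑ i, (r - w (φ i)) ≤ S.card * B := by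
        calc ∑ i, (r - w (φ i))
            = ∑ x ∈ Finset.univ.image (fun i => (⟨cls i, φ i⟩ : κ × β)), (r - w x.2) := by
              rw [Finset.sum_image (fun a _ b _ h => hinj h)]
          _ ≤ ∑ x ∈ (S.sigma J).image (fun x => (⟨x.1, x.2⟩ : κ × β)), (r - w x.2) := by
              refine Finset.sum_le_sum_of_subset ?_
              intro x hx
              simp only [Finset.mem_image, Finset.mem_univ, true_and] at hx
              obtain ⟨i, rfl⟩ := hx
              simp only [Finset.mem_image, Finset.mem_sigma]
              exact ⟨⟨cls i, φ i⟩, ⟨hS i, hφ i⟩, rfl⟩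
          _ = ∑ x ∈ S.sigma J, (r - w x.2) := by
              rw [Finset.sum_image]
              rintro ⟨a, b⟩ _ ⟨a', b'⟩ _ h
              simp only [Prod.mk.injEq] at h
              obtain ⟨rfl, rfl⟩ := h
              rfl
          _ = ∑ s ∈ S, ∑ b ∈ J s, (r - w b) := Finset.sum_sigma _ _ _
          _ ≤ S.card * B := by
              simpa using Finset.sum_le_card_nsmul S _ B hB
      have h2 : r * Fintype.card ι ≤ ∑ i, w (φ i) + ∑ i, (r - w (φ i)) := by
        rw [← Finset.sum_add_distrib]
        calc r * Fintype.card ι = ∑ _i : ι, r := by simp [mul_comm]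
          _ ≤ _ := Finset.sum_le_sum fun i _ => by omega
      omega
    · rw [Function.Injective] at hinj
      push Not at hinj
      obtain ⟨i, j, hij, hne⟩ := hinj
      simp only [Prod.mk.injEq] at hij
      have : Matrix.det (fun i => W (cls i) (φ i)) = 0 := by
        refine Matrix.det_zero_of_row_eq hne ?_
        funext l
        rw [hij.1, hij.2]
      rw [this, mul_zero]
      exact dvd_zero _
  have := dvd_add ((pow_dvd_pow π hGk).trans hred) hmain
  simpa using this

/-- Functions which are, modulo `π ^ k`, combinations of the monomials `s ^ i * t ^ j` with
`(i, j) ∈ J`. -/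
def monomialSpan {X R : Type*} [CommRing R] (π : R) (k : ℕ) (s t : X → R) (J : Finset (ℕ × ℕ)) :
    Submodule R (X → R) :=
  Submodule.span R ((fun p : ℕ × ℕ => fun x => s x ^ p.1 * t x ^ p.2) '' (J : Set (ℕ × ℕ))) ⊔
    Submodule.pi Set.univ fun _ => Ideal.span {π ^ k}

section MonomialSpan

variable {X R : Type*} [CommRing R] {π : R} {k : ℕ} {s t : X → R} {J : Finset (ℕ × ℕ)}

lemma mem_monomialSpan_of_dvd {g : X → R} (hg : ∀ x, π ^ k ∣ g x) :
    g ∈ monomialSpan π k s t J := by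
  refine Submodule.mem_sup_right ?_
  simpa [Submodule.mem_pi, Ideal.mem_span_singleton] using hg

lemma mem_monomialSpan_of_mem {p : ℕ × ℕ} (hp : p ∈ J) :
    (fun x => s x ^ p.1 * t x ^ p.2) ∈ monomialSpan π k s t J :=
  Submodule.mem_sup_left (Submodule.subset_span ⟨p, hp, rfl⟩)

lemma exists_of_mem_monomialSpan {g : X → R} (hg : g ∈ monomialSpan π k s t J) :
    ∃ (W : ℕ × ℕ → R) (V : X → R),
      ∀ x, g x = ∑ p ∈ J, s x ^ p.1 * t x ^ p.2 * W p + π ^ k * V x := by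
  classical
  obtain ⟨u, hu, v, hv, rfl⟩ := Submodule.mem_sup.mp hg
  obtain ⟨W, rfl⟩ := (Submodule.mem_span_image_finset_iff_exists_fun' R).mp hu
  have hv' : ∀ x, π ^ k ∣ v x := by
    simpa [Submodule.mem_pi, Ideal.mem_span_singleton] using hv
  choose V hV using hv'
  refine ⟨W, V, fun x => ?_⟩
  simp only [Pi.add_apply, Finset.sum_apply, Pi.smul_apply, smul_eq_mul, ← hV]
  congr 1
  exact Finset.sum_congr rfl fun p _ => mul_comm _ _

lemma evalEval_eq_sum_sum {R : Type*} [CommRing R] (h : Polynomial (Polynomial R)) (x y : R) :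
    h.evalEval x y = h.sum fun i c => c.sum fun j r => r * (y ^ i * x ^ j) := by
  rw [Polynomial.evalEval, Polynomial.eval_eq_sum (p := h), Polynomial.sum,
    Polynomial.eval_finsetSum, Polynomial.sum]
  refine Finset.sum_congr rfl fun i _ => ?_
  simp only [Polynomial.eval_mul, Polynomial.eval_pow, Polynomial.eval_C]
  rw [Polynomial.eval_eq_sum, Polynomial.sum, Polynomial.sum, Finset.sum_mul]
  exact Finset.sum_congr rfl fun j _ => by ring

lemma evalEval_mem_monomialSpan
    (hmon : ∀ i j, (fun x => s x ^ i * t x ^ j) ∈ monomialSpan π k s t J)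
    (h : Polynomial (Polynomial R)) :
    (fun x => h.evalEval (t x) (s x)) ∈ monomialSpan π k s t J := by
  have : (fun x => h.evalEval (t x) (s x)) =
      h.sum fun i c => c.sum fun j r => r • fun x => s x ^ i * t x ^ j := by
    funext x
    rw [evalEval_eq_sum_sum]
    simp [Polynomial.sum, Finset.sum_apply]
  rw [this]
  exact Submodule.sum_mem _ fun i _ => Submodule.sum_mem _ fun j _ =>
    Submodule.smul_mem _ _ (hmon i j)

lemma monomial_dvd {x : X} (hs : ∀ x, π ∣ s x) (ht : ∀ x, π ∣ t x) {i j : ℕ} (hk : k ≤ i + j) :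
    π ^ k ∣ s x ^ i * t x ^ j :=
  (pow_dvd_pow π hk).trans
    (by rw [pow_add]; exact mul_dvd_mul (pow_dvd_pow_of_dvd (hs x) i) (pow_dvd_pow_of_dvd (ht x) j))

lemma monomial_mem_monomialSpan_box (hs : ∀ x, π ∣ s x) (ht : ∀ x, π ∣ t x) (i j : ℕ) :
    (fun x => s x ^ i * t x ^ j) ∈
      monomialSpan π k s t (Finset.range k ×ˢ Finset.range k) := by
  by_cases h : i < k ∧ j < k
  · exact mem_monomialSpan_of_mem (p := (i, j)) (by simpa using h)
  · exact mem_monomialSpan_of_dvd fun x => monomial_dvd hs ht (by omega)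

/-- Division by a local equation with leading monomial `s ^ a * t ^ b`. -/
lemma monomial_mem_monomialSpan_of_evalEval_eq_zero (hs : ∀ x, π ∣ s x) (ht : ∀ x, π ∣ t x)
    (Φ : Polynomial (Polynomial R)) (hΦ : ∀ x, Φ.evalEval (t x) (s x) = 0) {a b : ℕ}
    (hab : IsUnit ((Φ.coeff a).coeff b))
    (hlow : ∀ i j, i + j < a + b → π ∣ (Φ.coeff i).coeff j)
    (hlex : ∀ i j, i + j = a + b → a < i → π ∣ (Φ.coeff i).coeff j) (i j : ℕ) :
    (fun x => s x ^ i * t x ^ j) ∈ monomialSpan π k s t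
      ((Finset.range k ×ˢ Finset.range k).filter fun p => p.1 < a ∨ p.2 < b) := by
  set T := monomialSpan π k s t
      ((Finset.range k ×ˢ Finset.range k).filter fun p => p.1 < a ∨ p.2 < b) with hT
  suffices H : ∀ e l, k ≤ l + e → ∀ n i j, k ≤ i + j + n →
      π ^ l • (fun x => s x ^ i * t x ^ j) ∈ T by
    simpa using H k 0 (by omega) k i j (by omega)
  intro e
  induction e with
  | zero =>
    intro l hl n i j _
    refine mem_monomialSpan_of_dvd fun x => ?_
    simp only [Pi.smul_apply, smul_eq_mul]
    exact Dvd.dvd.mul_right (pow_dvd_pow π (by omega)) _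
  | succ e ihe =>
    intro l hl n
    induction n with
    | zero =>
      intro i j hij
      exact Submodule.smul_mem _ _ (mem_monomialSpan_of_dvd fun x => monomial_dvd hs ht (by omega))
    | succ n ihn =>
      intro i
      induction i using Nat.strong_induction_on with
      | _ i ihi =>
      intro j hij
      by_cases hk : k ≤ i + j
      · exact Submodule.smul_mem _ _ (mem_monomialSpan_of_dvd fun x => monomial_dvd hs ht hk)
      by_cases hstd : i < a ∨ j < b
      · refine Submodule.smul_mem _ _ (mem_monomialSpan_of_mem (p := (i, j)) ?_)
        simp only [Finset.mem_filter, Finset.mem_product, Finset.mem_range]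
        exact ⟨⟨by omega, by omega⟩, hstd⟩
      obtain ⟨i₀, rfl⟩ : ∃ i₀, i = a + i₀ := ⟨i - a, by omega⟩
      obtain ⟨j₀, rfl⟩ : ∃ j₀, j = b + j₀ := ⟨j - b, by omega⟩
      have hterm : ∀ i' j', (i', j') ≠ (a, b) →
          (Φ.coeff i').coeff j' • π ^ l • (fun x => s x ^ (i' + i₀) * t x ^ (j' + j₀)) ∈ T := by
        intro i' j' hne
        have hpi : π ∣ (Φ.coeff i').coeff j' →
            (Φ.coeff i').coeff j' • π ^ l • (fun x => s x ^ (i' + i₀) * t x ^ (j' + j₀)) ∈ T := by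
          rintro ⟨v, hv⟩
          have := Submodule.smul_mem T v
            (ihe (l + 1) (by omega) k (i' + i₀) (j' + j₀) (by omega))
          rw [hv]
          convert this using 1
          rw [smul_smul, smul_smul]
          congr 1
          ring
        rcases lt_trichotomy (i' + j') (a + b) with h | h | h
        · exact hpi (hlow i' j' h)
        · rcases lt_trichotomy i' a with h' | h' | h'
          · exact Submodule.smul_mem _ _ (ihi (i' + i₀) (by omega) (j' + j₀) (by omega))
          · exact absurd (Prod.ext h' (by simp only; omega)) hne
          · exact hpi (hlex i' j' h h')
        · exact Submodule.smul_mem _ _ (ihn (i' + i₀) (j' + j₀) (by omega))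
      have hsum : ∑ i' ∈ Φ.support ∪ {a}, ∑ j' ∈ (Φ.coeff i').support ∪ {b},
          (Φ.coeff i').coeff j' • π ^ l • (fun x => s x ^ (i' + i₀) * t x ^ (j' + j₀)) =
            (0 : X → R) := by
        funext x
        have h0 := hΦ x
        rw [evalEval_eq_sum_sum, Polynomial.sum_eq_of_subset (s := Φ.support ∪ {a}) _
          (by simp) Finset.subset_union_left] at h0
        simp only [Finset.sum_apply, Pi.smul_apply, smul_eq_mul, Pi.zero_apply]
        rw [← mul_zero (π ^ l * (s x ^ i₀ * t x ^ j₀)), ← h0, Finset.mul_sum]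
        refine Finset.sum_congr rfl fun i' _ => ?_
        rw [Polynomial.sum_eq_of_subset (s := (Φ.coeff i').support ∪ {b}) _
          (by simp) Finset.subset_union_left, Finset.mul_sum]
        refine Finset.sum_congr rfl fun j' _ => ?_
        ring
      have hunit :
          (Φ.coeff a).coeff b • π ^ l • (fun x => s x ^ (a + i₀) * t x ^ (b + j₀)) ∈ T := by
        rw [← Finset.add_sum_erase _ _ (show a ∈ Φ.support ∪ {a} by simp),
          ← Finset.add_sum_erase _ _ (show b ∈ (Φ.coeff a).support ∪ {b} by simp), add_assoc]
          at hsum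
        rw [eq_neg_of_add_eq_zero_left hsum]
        refine Submodule.neg_mem _ (Submodule.add_mem _ ?_ ?_)
        · refine Submodule.sum_mem _ fun j' hj' => hterm a j' ?_
          simp [Finset.ne_of_mem_erase hj']
        · refine Submodule.sum_mem _ fun i' hi' => Submodule.sum_mem _ fun j' _ => hterm i' j' ?_
          simp [Finset.ne_of_mem_erase hi']
      obtain ⟨u, hu⟩ := hab
      rw [← hu] at hunit
      have := Submodule.smul_mem T (↑u⁻¹ : R) hunit
      rwa [smul_smul, Units.inv_mul, one_smul] at this

end MonomialSpan

/-- The Taylor expansion of a bivariate polynomial at the point `(a, b)`, where `a` is substituted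
for the outer and `b` for the inner variable. -/
noncomputable def biTaylor {R : Type*} [CommRing R] (a b : R) (F : Polynomial (Polynomial R)) :
    Polynomial (Polynomial R) :=
  (Polynomial.taylor (Polynomial.C a) F).map (Polynomial.taylorAlgHom b : _ →+* Polynomial R)

lemma coeff_biTaylor {R : Type*} [CommRing R] (a b : R) (F : Polynomial (Polynomial R)) (i : ℕ) :
    (biTaylor a b F).coeff i =
      Polynomial.taylor b ((Polynomial.taylor (Polynomial.C a) F).coeff i) := by
  rw [biTaylor, Polynomial.coeff_map]
  rfl

lemma evalEval_biTaylor {R : Type*} [CommRing R] (a b : R) (F : Polynomial (Polynomial R))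
    (x y : R) : (biTaylor a b F).evalEval y x = F.evalEval (y + b) (x + a) := by
  have h : (Polynomial.evalRingHom y).comp (Polynomial.taylorAlgHom b : _ →+* Polynomial R) =
      Polynomial.evalRingHom (y + b) := by
    ext <;> simp
  have e : ∀ (G : Polynomial (Polynomial R)) (u v : R),
      G.evalEval u v = (G.map (Polynomial.evalRingHom u)).eval v := by
    intro G u v
    rw [Polynomial.map_evalRingHom_eval]
  rw [e, e, biTaylor, Polynomial.map_map, h, Polynomial.map_taylor, Polynomial.taylor_eval]
  simp

lemma map_biTaylor {R S : Type*} [CommRing R] [CommRing S] (φ : R →+* S) (a b : R)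
    (F : Polynomial (Polynomial R)) (i j : ℕ) :
    ((biTaylor (φ a) (φ b) (F.map (Polynomial.mapRingHom φ))).coeff i).coeff j =
      φ (((biTaylor a b F).coeff i).coeff j) := by
  have h : Polynomial.C (φ a) = Polynomial.mapRingHom φ (Polynomial.C a) := by simp
  rw [coeff_biTaylor, coeff_biTaylor, h, ← Polynomial.map_taylor, Polynomial.coeff_map,
    Polynomial.coe_mapRingHom, ← Polynomial.map_taylor, Polynomial.coeff_map]

lemma natDegree_coeff_taylor_C_le {R : Type*} [CommRing R] (a : R) {F : Polynomial (Polynomial R)}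
    {d : ℕ} (hF : ∀ i, (F.coeff i).natDegree ≤ d) (i : ℕ) :
    ((Polynomial.taylor (Polynomial.C a) F).coeff i).natDegree ≤ d := by
  rw [Polynomial.taylor_coeff, Polynomial.hasseDeriv_apply, Polynomial.sum,
    Polynomial.eval_finsetSum]
  refine Polynomial.natDegree_sum_le_of_forall_le _ _ fun n _ => ?_
  rw [Polynomial.eval_monomial, ← Polynomial.C_pow]
  refine (Polynomial.natDegree_mul_C_le _ _).trans ?_
  rw [← Polynomial.C_eq_natCast]
  exact (Polynomial.natDegree_C_mul_le _ _).trans (hF n)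

lemma sum_count_le_card {α : Type*} [DecidableEq α] (s : Finset α) (m : Multiset α) :
    ∑ a ∈ s, m.count a ≤ m.card := by
  rw [← Multiset.sum_count_eq_card (s := s ∪ m.toFinset) (m := m) (by simp +contextual)]
  exact Finset.sum_le_sum_of_subset Finset.subset_union_left

open Classical in
/-- A bivariate form of the Schwartz–Zippel lemma with multiplicities. -/
lemma mul_card_multiplicity_le {K : Type*} [Field K] [Fintype K]
    {F : Polynomial (Polynomial K)} (hF0 : F ≠ 0) {d : ℕ} (hd : F.natDegree ≤ d)
    (hF : ∀ i, (F.coeff i).natDegree ≤ d) (m : ℕ) :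
    m * (Finset.univ.filter fun p : K × K =>
      ∀ i j, i + j < m → ((biTaylor p.1 p.2 F).coeff i).coeff j = 0).card ≤
      2 * d * Fintype.card K := by
  set n : K → ℕ := fun a => F.rootMultiplicity (Polynomial.C a) with hn
  have htr : ∀ a, n a = (Polynomial.taylor (Polynomial.C a) F).natTrailingDegree := fun a => by
    rw [hn, Polynomial.taylor_apply]
    exact Polynomial.rootMultiplicity_eq_natTrailingDegree
  have hsum : ∑ a, n a ≤ d := by
    refine le_trans ?_ ((Polynomial.card_roots' F).trans hd)
    calc ∑ a, n a = ∑ a ∈ Finset.univ.image (Polynomial.C : K → Polynomial K), F.roots.count a := by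
          rw [Finset.sum_image (fun a _ b _ h => Polynomial.C_injective h)]
          simp [hn]
      _ ≤ F.roots.card := by
          exact sum_count_le_card _ _
  have hcol : ∀ a : K, m * (Finset.univ.filter fun b : K =>
      ∀ i j, i + j < m → ((biTaylor a b F).coeff i).coeff j = 0).card ≤
      n a * Fintype.card K + d := by
    intro a
    set B := Finset.univ.filter fun b : K =>
      ∀ i j, i + j < m → ((biTaylor a b F).coeff i).coeff j = 0 with hB
    set c := (Polynomial.taylor (Polynomial.C a) F).coeff (n a) with hc
    have hc0 : c ≠ 0 := by
      rw [hc, htr]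
      have : Polynomial.taylor (Polynomial.C a) F ≠ 0 := by simpa using hF0
      exact Polynomial.trailingCoeff_nonzero_iff_nonzero.mpr this
    have hmult : ∀ b ∈ B, m - n a ≤ c.roots.count b := by
      intro b hb
      rw [hB, Finset.mem_filter] at hb
      rw [Polynomial.count_roots, Polynomial.rootMultiplicity_eq_natTrailingDegree,
        ← Polynomial.taylor_apply]
      refine Polynomial.le_natTrailingDegree ?_ fun j hj => ?_
      · simpa using hc0
      · have := hb.2 (n a) j (by omega)
        rwa [coeff_biTaylor] at this
    have h1 : B.card * (m - n a) ≤ d := by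
      calc B.card * (m - n a) = ∑ b ∈ B, (m - n a) := by simp
        _ ≤ ∑ b ∈ B, c.roots.count b := Finset.sum_le_sum hmult
        _ ≤ c.roots.card := sum_count_le_card _ _
        _ ≤ c.natDegree := Polynomial.card_roots' _
        _ ≤ d := natDegree_coeff_taylor_C_le a hF _
    have h2 : B.card ≤ Fintype.card K := Finset.card_le_univ _
    calc m * B.card ≤ (n a + (m - n a)) * B.card := Nat.mul_le_mul_right _ (by omega)
      _ = n a * B.card + B.card * (m - n a) := by ring
      _ ≤ _ := Nat.add_le_add (Nat.mul_le_mul_left _ h2) h1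
  have hcard : (Finset.univ.filter fun p : K × K =>
      ∀ i j, i + j < m → ((biTaylor p.1 p.2 F).coeff i).coeff j = 0).card =
      ∑ a : K, (Finset.univ.filter fun b : K =>
        ∀ i j, i + j < m → ((biTaylor a b F).coeff i).coeff j = 0).card := by
    simp only [Finset.card_filter]
    rw [Fintype.sum_prod_type]
  rw [hcard, Finset.mul_sum]
  calc _ ≤ ∑ a : K, (n a * Fintype.card K + d) := Finset.sum_le_sum fun a _ => hcol a
    _ = (∑ a, n a) * Fintype.card K + Fintype.card K * d := by
      rw [Finset.sum_add_distrib, Finset.sum_mul]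
      simp
    _ ≤ d * Fintype.card K + Fintype.card K * d := by gcongr
    _ = _ := by ring

/-- The dehomogenisation of a ternary form in its `i`-th affine chart. -/
noncomputable def dehom {R : Type*} [CommRing R] (i : Fin 3) (f : MvPolynomial (Fin 3) R) :
    Polynomial (Polynomial R) :=
  aeval (i.insertNth 1 ![Polynomial.X, Polynomial.C Polynomial.X] :
    Fin 3 → Polynomial (Polynomial R)) f

lemma evalEval_dehom {R : Type*} [CommRing R] (i : Fin 3) (f : MvPolynomial (Fin 3) R) (u v : R) :
    (dehom i f).evalEval v u = eval (i.insertNth 1 ![u, v] : Fin 3 → R) f := by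
  have h : (Polynomial.evalEvalRingHom v u).comp
      ((aeval (i.insertNth 1 ![Polynomial.X, Polynomial.C Polynomial.X] :
        Fin 3 → Polynomial (Polynomial R)) :
          MvPolynomial (Fin 3) R →ₐ[R] Polynomial (Polynomial R)) :
            MvPolynomial (Fin 3) R →+* Polynomial (Polynomial R)) =
      eval (i.insertNth 1 ![u, v] : Fin 3 → R) := by
    refine MvPolynomial.ringHom_ext (fun r => ?_) (fun l => ?_)
    · simp
    · refine Fin.succAboveCases i ?_ (fun l => ?_) l
      · simp
      · fin_cases l <;> simp
  exact congrArg (fun φ => φ f) h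

lemma map_dehom {R S : Type*} [CommRing R] [CommRing S] (φ : R →+* S) (i : Fin 3)
    (f : MvPolynomial (Fin 3) R) :
    (dehom i f).map (Polynomial.mapRingHom φ) = dehom i (map φ f) := by
  have h : (Polynomial.mapRingHom (Polynomial.mapRingHom φ)).comp
      ((aeval (i.insertNth 1 ![Polynomial.X, Polynomial.C Polynomial.X] :
        Fin 3 → Polynomial (Polynomial R)) :
          MvPolynomial (Fin 3) R →ₐ[R] Polynomial (Polynomial R)) :
            MvPolynomial (Fin 3) R →+* Polynomial (Polynomial R)) =
      ((aeval (i.insertNth 1 ![Polynomial.X, Polynomial.C Polynomial.X] :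
        Fin 3 → Polynomial (Polynomial S)) :
          MvPolynomial (Fin 3) S →ₐ[S] Polynomial (Polynomial S)) :
            MvPolynomial (Fin 3) S →+* Polynomial (Polynomial S)).comp (map φ) := by
    refine MvPolynomial.ringHom_ext (fun r => ?_) (fun l => ?_)
    · simp
    · refine Fin.succAboveCases i ?_ (fun l => ?_) l
      · simp
      · fin_cases l <;> simp
  exact congrArg (fun ψ => ψ f) h

lemma coeff_dehom {R : Type*} [CommRing R] (i : Fin 3) (f : MvPolynomial (Fin 3) R) (a b : ℕ) :
    ((dehom i f).coeff a).coeff b = ∑ m ∈ f.support,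
      if a = m (i.succAbove 0) ∧ b = m (i.succAbove 1) then f.coeff m else 0 := by
  rw [dehom, aeval_def, eval₂_eq', Polynomial.finsetSum_coeff, Polynomial.finsetSum_coeff]
  refine Finset.sum_congr rfl fun m _ => ?_
  rw [Fin.prod_univ_succAbove _ i, Fin.prod_univ_two]
  simp only [Fin.insertNth_apply_same, Fin.insertNth_apply_succAbove, one_pow, one_mul,
    Matrix.cons_val_zero, Matrix.cons_val_one, ← Polynomial.C_pow]
  rw [show algebraMap R (Polynomial (Polynomial R)) (coeff m f) =
    Polynomial.C (Polynomial.C (coeff m f)) from rfl, ← mul_assoc, Polynomial.coeff_mul_C,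
    Polynomial.coeff_C_mul, Polynomial.coeff_X_pow]
  split_ifs with h1 h2 h2
  · simp [h2.2]
  · have : b ≠ m (i.succAbove 1) := fun h => h2 ⟨h1, h⟩
    simp [Polynomial.coeff_X_pow, this]
  · exact absurd h2.1 h1
  · simp

lemma degree_succAbove {R : Type*} [CommRing R] {f : MvPolynomial (Fin 3) R} {d : ℕ}
    (hf : f.IsHomogeneous d) (i : Fin 3) {m : Fin 3 →₀ ℕ} (hm : m ∈ f.support) :
    m i + (m (i.succAbove 0) + m (i.succAbove 1)) = d := by
  have := hf (mem_support_iff.mp hm)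
  rw [← this, Pi.one_def, ← Finsupp.degree_eq_weight_one, Finsupp.degree_eq_sum,
    Fin.sum_univ_succAbove _ i, Fin.sum_univ_two]

lemma le_of_coeff_dehom_ne_zero {R : Type*} [CommRing R] {f : MvPolynomial (Fin 3) R} {d : ℕ}
    (hf : f.IsHomogeneous d) (i : Fin 3) {a b : ℕ} (h : ((dehom i f).coeff a).coeff b ≠ 0) :
    a + b ≤ d := by
  rw [coeff_dehom] at h
  obtain ⟨m, hm, hne⟩ := Finset.exists_ne_zero_of_sum_ne_zero h
  have := degree_succAbove hf i hm
  split_ifs at hne with hab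
  · omega
  · exact absurd rfl hne

lemma dehom_ne_zero {R : Type*} [CommRing R] {f : MvPolynomial (Fin 3) R} {d : ℕ}
    (hf : f.IsHomogeneous d) (hf0 : f ≠ 0) (i : Fin 3) : dehom i f ≠ 0 := by
  obtain ⟨m, hm⟩ := support_nonempty.mpr hf0
  have : ((dehom i f).coeff (m (i.succAbove 0))).coeff (m (i.succAbove 1)) = f.coeff m := by
    rw [coeff_dehom, Finset.sum_eq_single m]
    · simp
    · intro m' hm' hne
      rw [if_neg]
      rintro ⟨h0, h1⟩
      refine hne ?_
      have e := degree_succAbove hf i hm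
      have e' := degree_succAbove hf i hm'
      ext l
      refine Fin.succAboveCases i ?_ (fun l => ?_) l
      · omega
      · fin_cases l
        · exact h0.symm
        · exact h1.symm
    · exact fun h => absurd hm h
  intro h0
  rw [h0] at this
  simp only [Polynomial.coeff_zero] at this
  exact mem_support_iff.mp hm this.symm

open Classical in
/-- The points of the three affine charts of `ℙ²(K)` at which the form `f` has multiplicity at
least `m`. -/
noncomputable def highMultiplicity {K : Type*} [Field K] [Fintype K] (f : MvPolynomial (Fin 3) K)
    (m : ℕ) : Finset (Fin 3 × K × K) :=
  Finset.univ.filter fun c =>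
    ∀ i j, i + j < m → ((biTaylor c.2.1 c.2.2 (dehom c.1 f)).coeff i).coeff j = 0

lemma mul_card_highMultiplicity_le {K : Type*} [Field K] [Fintype K] {f : MvPolynomial (Fin 3) K}
    {d : ℕ} (hf : f.IsHomogeneous d) (hf0 : f ≠ 0) (m : ℕ) :
    m * (highMultiplicity f m).card ≤ 6 * d * Fintype.card K := by
  classical
  have hcard : (highMultiplicity f m).card = ∑ i : Fin 3, (Finset.univ.filter fun p : K × K =>
      ∀ i' j', i' + j' < m → ((biTaylor p.1 p.2 (dehom i f)).coeff i').coeff j' = 0).card := by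
    rw [highMultiplicity]
    simp only [Finset.card_filter]
    rw [Fintype.sum_prod_type]
  rw [hcard, Finset.mul_sum]
  calc _ ≤ ∑ _i : Fin 3, 2 * d * Fintype.card K := by
        refine Finset.sum_le_sum fun i _ => ?_
        have hc : ∀ a b, ((dehom i f).coeff a).coeff b ≠ 0 → a + b ≤ d :=
          fun a b => le_of_coeff_dehom_ne_zero hf i
        refine le_trans (le_of_eq ?_) (mul_card_multiplicity_le (dehom_ne_zero hf hf0 i) (d := d)
          ?_ ?_ m)
        · congr!
        · refine Polynomial.natDegree_le_iff_coeff_eq_zero.mpr fun a ha => ?_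
          ext b
          by_contra h
          have := hc a b h
          omega
        · refine fun a => Polynomial.natDegree_le_iff_coeff_eq_zero.mpr fun b hb => ?_
          by_contra h
          have := hc a b h
          omega
    _ = _ := by
      simp
      ring

/-- Entries of an interpolation determinant at points in one residue class. -/
lemma exists_expansion_monomials {R X : Type*} [CommRing R] {π : R} {k : ℕ} {s t : X → R}
    {J : Finset (ℕ × ℕ)}
    (hmon : ∀ i j, (fun x => s x ^ i * t x ^ j) ∈ monomialSpan π k s t J) (l : Fin 3) (a b : R)
    (m : Fin 3 →₀ ℕ) :
    ∃ (W : ℕ × ℕ → R) (V : X → R), ∀ x,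
      ∏ j, (l.insertNth 1 ![a + s x, b + t x] : Fin 3 → R) j ^ m j =
        ∑ p ∈ J, s x ^ p.1 * t x ^ p.2 * W p + π ^ k * V x := by
  obtain ⟨W, V, h⟩ := exists_of_mem_monomialSpan
    (evalEval_mem_monomialSpan hmon (biTaylor a b (dehom l (monomial m 1))))
  refine ⟨W, V, fun x => ?_⟩
  rw [← h, evalEval_biTaylor, evalEval_dehom, eval_monomial, one_mul, Finsupp.prod_fintype _ _
    (by simp), add_comm a, add_comm b]

/-- Divisibility of the interpolation determinant at points distributed over residue classes. -/
lemma pow_dvd_det_monomials {ι κ R : Type*} [Fintype ι] [DecidableEq ι] [CommRing R]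
    (π : R) {r B G D : ℕ} (e : ι → Fin 3 →₀ ℕ) (he : ∀ m, (e m).degree = D)
    (z : ι → Fin 3 → R) (cls : ι → κ) (chart : κ → Fin 3) (a b : κ → R) (ε s t : ι → R)
    (hz : ∀ x l, z x l = ε x * ((chart (cls x)).insertNth 1
      ![a (cls x) + π * s x, b (cls x) + π * t x] : Fin 3 → R) l)
    (J : κ → Finset (ℕ × ℕ)) (S : Finset κ) (hS : ∀ x, cls x ∈ S)
    (hJ : ∀ c i j, (fun x : {x // cls x = c} => (π * s x) ^ i * (π * t x) ^ j) ∈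
      monomialSpan π G (fun x : {x // cls x = c} => π * s x) (fun x => π * t x) (J c))
    (hB : ∀ c ∈ S, ∑ p ∈ J c, (r - (p.1 + p.2)) ≤ B)
    (hG : G + S.card * B ≤ r * Fintype.card ι) :
    π ^ G ∣ Matrix.det (Matrix.of fun x m => ∏ l, z x l ^ e m l) := by
  have H : ∀ c m, ∃ (W : ℕ × ℕ → R) (V : {x // cls x = c} → R), ∀ x : {x // cls x = c},
      ∏ j, ((chart c).insertNth 1 ![a c + π * s x, b c + π * t x] : Fin 3 → R) j ^ e m j =
        ∑ p ∈ J c, (π * s x) ^ p.1 * (π * t x) ^ p.2 * W p + π ^ G * V x :=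
    fun c m => exists_expansion_monomials (hJ c) (chart c) (a c) (b c) (e m)
  choose W V hWV using H
  refine pow_dvd_det_of_rows π _ cls J (fun p => p.1 + p.2)
    (fun x p => ε x ^ D * (s x ^ p.1 * t x ^ p.2)) (fun c p m => W c m p)
    (fun x m => ε x ^ D * V (cls x) m ⟨x, rfl⟩) (fun x m => ?_) S hS hB le_rfl hG
  have h := hWV (cls x) m ⟨x, rfl⟩
  simp only [Matrix.of_apply, hz, mul_pow, Finset.prod_mul_distrib]
  rw [h, Finset.prod_pow_eq_pow_sum, ← Finsupp.degree_eq_sum, he, mul_add, Finset.mul_sum]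
  congr 1
  · refine Finset.sum_congr rfl fun p _ => ?_
    ring
  · ring

lemma sum_sub_le_card_mul {J T : Finset (ℕ × ℕ)} {r : ℕ} (h : ∀ p ∈ J, p.1 + p.2 < r → p ∈ T) :
    ∑ p ∈ J, (r - (p.1 + p.2)) ≤ T.card * r := by
  calc ∑ p ∈ J, (r - (p.1 + p.2)) = ∑ p ∈ J.filter (fun p => p.1 + p.2 < r), (r - (p.1 + p.2)) := by
        rw [Finset.sum_filter_of_ne]
        intro p _ hp
        omega
    _ ≤ ∑ p ∈ J.filter (fun p => p.1 + p.2 < r), r := Finset.sum_le_sum fun p _ => by omega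
    _ ≤ ∑ _p ∈ T, r := Finset.sum_le_sum_of_subset fun p hp => by
        rw [Finset.mem_filter] at hp
        exact h p hp.1 hp.2
    _ = T.card * r := by simp

lemma sum_box_sub_le (k r : ℕ) :
    ∑ p ∈ Finset.range k ×ˢ Finset.range k, (r - (p.1 + p.2)) ≤ r ^ 3 := by
  refine (sum_sub_le_card_mul (T := Finset.range r ×ˢ Finset.range r) fun p _ h => ?_).trans
    (le_of_eq ?_)
  · simp only [Finset.mem_product, Finset.mem_range]
    omega
  · simp
    ring

lemma sum_standard_sub_le (k r a b : ℕ) :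
    ∑ p ∈ (Finset.range k ×ˢ Finset.range k).filter (fun p => p.1 < a ∨ p.2 < b),
      (r - (p.1 + p.2)) ≤ (a + b) * r ^ 2 := by
  refine (sum_sub_le_card_mul (T := Finset.range a ×ˢ Finset.range r ∪
    Finset.range r ×ˢ Finset.range b) fun p hp h => ?_).trans ?_
  · simp only [Finset.mem_filter, Finset.mem_union, Finset.mem_product, Finset.mem_range] at hp ⊢
    omega
  · calc _ ≤ ((Finset.range a ×ˢ Finset.range r).card +
          (Finset.range r ×ˢ Finset.range b).card) * r :=
        Nat.mul_le_mul_right _ (Finset.card_union_le _ _)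
      _ = _ := by
        simp
        ring

section Padic

variable {q : ℕ} [Fact q.Prime]

lemma toZMod_eq_zero_iff_dvd (x : ℤ_[q]) : PadicInt.toZMod x = 0 ↔ (q : ℤ_[q]) ∣ x := by
  rw [← RingHom.mem_ker, PadicInt.ker_toZMod, PadicInt.maximalIdeal_eq_span_p,
    Ideal.mem_span_singleton]

lemma isUnit_of_toZMod_ne_zero {x : ℤ_[q]} (hx : PadicInt.toZMod x ≠ 0) : IsUnit x := by
  rw [Ne, toZMod_eq_zero_iff_dvd, ← PadicInt.norm_lt_one_iff_dvd, ← PadicInt.not_isUnit_iff] at hx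
  exact not_not.mp hx

lemma exists_eq_cast_add (x : ℤ_[q]) :
    ∃ (a : ZMod q) (s : ℤ_[q]), x = (a.cast : ℤ_[q]) + q * s := by
  have h := PadicInt.toZMod_spec x
  rw [PadicInt.maximalIdeal_eq_span_p, Ideal.mem_span_singleton] at h
  obtain ⟨s, hs⟩ := h
  exact ⟨PadicInt.toZMod x, s, by rw [← hs]; ring⟩

lemma toZMod_cast (a : ZMod q) : PadicInt.toZMod (a.cast : ℤ_[q]) = a := by
  rw [ZMod.cast_eq_val, map_natCast, ZMod.natCast_zmod_val]

/-- The integer vector `z` represents a projective point which in the affine chart `c.1` reduces to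
the point `(c.2.1, c.2.2)` modulo `q`. -/
def InClass (q : ℕ) [Fact q.Prime] (z : Fin 3 → ℤ) (c : Fin 3 × ZMod q × ZMod q) : Prop :=
  ∃ ε s t : ℤ_[q], ε ≠ 0 ∧ ∀ l, (z l : ℤ_[q]) = ε *
    (c.1.insertNth 1 ![(c.2.1.cast : ℤ_[q]) + q * s, (c.2.2.cast : ℤ_[q]) + q * t] :
      Fin 3 → ℤ_[q]) l

lemma exists_inClass {z : Fin 3 → ℤ} (hz : Finset.univ.gcd z = 1) : ∃ c, InClass q z c := by
  obtain ⟨i, hi⟩ : ∃ i, ¬ (q : ℤ) ∣ z i := by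
    by_contra! h
    have := Finset.dvd_gcd (s := Finset.univ) (f := z) fun i _ => h i
    rw [hz] at this
    exact (Nat.prime_iff_prime_int.mp (Fact.out : q.Prime)).not_dvd_one this
  have hu : IsUnit (z i : ℤ_[q]) := by
    by_contra h
    rw [PadicInt.not_isUnit_iff, PadicInt.norm_int_lt_one_iff_dvd] at h
    exact hi h
  obtain ⟨u, hu⟩ := hu
  obtain ⟨a, s, ha⟩ := exists_eq_cast_add ((↑u⁻¹ : ℤ_[q]) * (z (i.succAbove 0) : ℤ_[q]))
  obtain ⟨b, t, hb⟩ := exists_eq_cast_add ((↑u⁻¹ : ℤ_[q]) * (z (i.succAbove 1) : ℤ_[q]))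
  refine ⟨(i, a, b), u, s, t, u.ne_zero, fun l => ?_⟩
  refine Fin.succAboveCases i ?_ (fun l => ?_) l
  · simp [hu]
  · fin_cases l
    · simp [← ha]
    · simp [← hb]

lemma exists_padic_form {f : MvPolynomial (Fin 3) ℚ} {d : ℕ} (hf0 : f ≠ 0)
    (hf : f.IsHomogeneous d) :
    ∃ F : MvPolynomial (Fin 3) ℤ_[q], F.IsHomogeneous d ∧ map PadicInt.toZMod F ≠ 0 ∧
      ∀ z : Fin 3 → ℤ, eval (fun l => (z l : ℚ)) f = 0 → eval (fun l => (z l : ℤ_[q])) F = 0 := by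
  obtain ⟨m₀, hm₀, hmax⟩ := Finset.exists_max_image f.support
    (fun m => ‖((f.coeff m : ℚ) : ℚ_[q])‖) (support_nonempty.mpr hf0)
  set a : ℚ_[q] := ((f.coeff m₀ : ℚ) : ℚ_[q]) with ha
  have ha0 : a ≠ 0 := by simpa [ha] using mem_support_iff.mp hm₀
  have hle : ∀ m, ‖((f.coeff m : ℚ) : ℚ_[q]) / a‖ ≤ 1 := by
    intro m
    rw [norm_div, div_le_one (norm_pos_iff.mpr ha0)]
    by_cases hm : m ∈ f.support
    · exact hmax m hm
    · rw [notMem_support_iff.mp hm]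
      simp
  obtain ⟨g, hg⟩ : ∃ g : (Fin 3 →₀ ℕ) → ℤ_[q],
      ∀ m, ((g m : ℤ_[q]) : ℚ_[q]) = ((f.coeff m : ℚ) : ℚ_[q]) / a :=
    ⟨fun m => ⟨_, hle m⟩, fun _ => rfl⟩
  have hg1 : g m₀ = 1 := by
    apply Subtype.coe_injective
    change ((g m₀ : ℤ_[q]) : ℚ_[q]) = ((1 : ℤ_[q]) : ℚ_[q])
    rw [hg, ← ha, div_self ha0, PadicInt.coe_one]
  refine ⟨∑ m ∈ f.support, monomial m (g m), ?_, ?_, ?_⟩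
  · refine IsHomogeneous.sum _ _ _ fun m hm => isHomogeneous_monomial _ ?_
    have := hf (mem_support_iff.mp hm)
    rw [← this, Pi.one_def, ← Finsupp.degree_eq_weight_one]
  · intro h0
    have h1 := congrArg (coeff m₀) h0
    rw [coeff_map, coeff_sum, Finset.sum_eq_single m₀, coeff_monomial, if_pos rfl, hg1, map_one,
      coeff_zero] at h1
    · exact one_ne_zero h1
    · intro m' _ hne
      rw [coeff_monomial, if_neg hne]
    · exact fun h => absurd hm₀ h
  · intro z hz
    apply Subtype.coe_injective
    have h1 : ((eval (fun l => (z l : ℤ_[q])) (∑ m ∈ f.support, monomial m (g m)) : ℤ_[q]) :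
        ℚ_[q]) = (eval (fun l => (z l : ℚ)) f : ℚ) / a := by
      rw [map_sum, eval_eq', PadicInt.coe_sum]
      push_cast
      rw [Finset.sum_div]
      refine Finset.sum_congr rfl fun m _ => ?_
      rw [eval_monomial, Finsupp.prod_fintype _ _ (by simp)]
      have h2 : ((∏ l, (z l : ℤ_[q]) ^ m l : ℤ_[q]) : ℚ_[q]) = ∏ l, (z l : ℚ_[q]) ^ m l := by
        change PadicInt.Coe.ringHom (∏ l, (z l : ℤ_[q]) ^ m l) = _
        rw [map_prod]
        refine Finset.prod_congr rfl fun l _ => ?_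
        rw [map_pow, map_intCast]
      rw [PadicInt.coe_mul, h2, hg]
      ring
    rw [hz] at h1
    simpa using h1

lemma eval_const_mul {σ R : Type*} [Fintype σ] [CommRing R] {F : MvPolynomial σ R} {d : ℕ}
    (hF : F.IsHomogeneous d) (ε : R) (v : σ → R) :
    eval (fun l => ε * v l) F = ε ^ d * eval v F := by
  rw [eval_eq', eval_eq', Finset.mul_sum]
  refine Finset.sum_congr rfl fun m hm => ?_
  have h := hF (mem_support_iff.mp hm)
  rw [Pi.one_def, ← Finsupp.degree_eq_weight_one, Finsupp.degree_eq_sum] at h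
  simp only [mul_pow, Finset.prod_mul_distrib]
  rw [Finset.prod_pow_eq_pow_sum, h]
  ring

variable {ι : Type*} [Fintype ι] [DecidableEq ι] {r G D : ℕ} {e : ι → Fin 3 →₀ ℕ}
  {z : ι → Fin 3 → ℤ}

lemma pow_dvd_det_of_padic
    (h : (q : ℤ_[q]) ^ G ∣ Matrix.det (Matrix.of fun x m => ∏ l, (z x l : ℤ_[q]) ^ e m l)) :
    (q : ℤ) ^ G ∣ Matrix.det (Matrix.of fun x m => ∏ l, z x l ^ e m l) := by
  rw [← PadicInt.pow_p_dvd_int_iff]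
  convert h
  have := RingHom.map_det (Int.castRingHom ℤ_[q]) (Matrix.of fun x m => ∏ l, z x l ^ e m l)
  rw [eq_intCast] at this
  rw [this]
  congr 1
  ext x m
  simp

lemma pow_dvd_det_of_inClass (he : ∀ m, (e m).degree = D)
    (S : Finset (Fin 3 × ZMod q × ZMod q)) (hz : ∀ x, ∃ c ∈ S, InClass q (z x) c)
    (hG : G + S.card * r ^ 3 ≤ r * Fintype.card ι) :
    (q : ℤ) ^ G ∣ Matrix.det (Matrix.of fun x m => ∏ l, z x l ^ e m l) := by
  apply pow_dvd_det_of_padic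
  choose cls hS ε s t _ h using hz
  exact pow_dvd_det_monomials (q : ℤ_[q]) e he (fun x l => (z x l : ℤ_[q])) cls (fun c => c.1)
    (fun c => c.2.1.cast) (fun c => c.2.2.cast) ε s t h
    (fun _ => Finset.range G ×ˢ Finset.range G) S hS
    (fun c => monomial_mem_monomialSpan_box (fun x => dvd_mul_right _ _)
      (fun x => dvd_mul_right _ _))
    (fun c _ => sum_box_sub_le _ _) hG

lemma exists_minimal_coeff {K : Type*} [CommRing K] (Φ : Polynomial (Polynomial K)) {m : ℕ}
    (h : ∃ i j, i + j < m ∧ (Φ.coeff i).coeff j ≠ 0) :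
    ∃ a b, a + b < m ∧ (Φ.coeff a).coeff b ≠ 0 ∧
      (∀ i j, i + j < a + b → (Φ.coeff i).coeff j = 0) ∧
      ∀ i j, i + j = a + b → a < i → (Φ.coeff i).coeff j = 0 := by
  classical
  have hex : ∃ n, ∃ i j, i + j = n ∧ (Φ.coeff i).coeff j ≠ 0 := by
    obtain ⟨i, j, _, h⟩ := h
    exact ⟨_, i, j, rfl, h⟩
  set n := Nat.find hex with hn
  have hmin : ∀ i j, i + j < n → (Φ.coeff i).coeff j = 0 := by
    intro i j hij
    by_contra hne
    exact Nat.find_min hex hij ⟨i, j, rfl, hne⟩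
  have hnm : n < m := by
    obtain ⟨i, j, hij, h⟩ := h
    by_contra hlt
    exact h (hmin i j (by omega))
  obtain ⟨a, ha, hmax⟩ := Finset.exists_max_image
    ((Finset.range (n + 1)).filter fun i => (Φ.coeff i).coeff (n - i) ≠ 0) id (by
      obtain ⟨i, j, hij, h⟩ := Nat.find_spec hex
      refine ⟨i, ?_⟩
      rw [← hn] at hij
      rw [Finset.mem_filter, Finset.mem_range, show n - i = j by omega]
      exact ⟨by omega, h⟩)
  rw [Finset.mem_filter, Finset.mem_range] at ha
  have hab : a + (n - a) = n := by omega
  refine ⟨a, n - a, by omega, ha.2, fun i j hij => hmin i j (by omega), fun i j hij hai => ?_⟩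
  by_contra hne
  have : id i ≤ id a := hmax i (by
    rw [Finset.mem_filter, Finset.mem_range, show n - i = j by omega]
    exact ⟨by omega, hne⟩)
  exact absurd this (not_le.mpr hai)

lemma pow_dvd_det_of_notMem_highMultiplicity (he : ∀ m, (e m).degree = D)
    {F : MvPolynomial (Fin 3) ℤ_[q]} {d : ℕ} (hF : F.IsHomogeneous d)
    (hzF : ∀ x, eval (fun l => (z x l : ℤ_[q])) F = 0) {m : ℕ} {c : Fin 3 × ZMod q × ZMod q}
    (hc : c ∉ highMultiplicity (map PadicInt.toZMod F) m) (hz : ∀ x, InClass q (z x) c)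
    (hG : G + m * r ^ 2 ≤ r * Fintype.card ι) :
    (q : ℤ) ^ G ∣ Matrix.det (Matrix.of fun x m => ∏ l, z x l ^ e m l) := by
  apply pow_dvd_det_of_padic
  choose ε s t hε h using hz
  set Φ := biTaylor (c.2.1.cast : ℤ_[q]) (c.2.2.cast : ℤ_[q]) (dehom c.1 F) with hΦ
  have hred : ∀ i j, ((biTaylor c.2.1 c.2.2
      (dehom c.1 (map PadicInt.toZMod F))).coeff i).coeff j =
        PadicInt.toZMod ((Φ.coeff i).coeff j) := by
    intro i j
    rw [hΦ, ← map_biTaylor, toZMod_cast, toZMod_cast, map_dehom]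
  have hc' : ∃ i j, i + j < m ∧ ((biTaylor c.2.1 c.2.2
      (dehom c.1 (map PadicInt.toZMod F))).coeff i).coeff j ≠ 0 := by
    simpa [highMultiplicity] using hc
  obtain ⟨a, b, habm, hne, hlow, hlex⟩ := exists_minimal_coeff _ hc'
  simp only [hred, toZMod_eq_zero_iff_dvd] at hlow hlex
  rw [hred] at hne
  have hvan : ∀ x, Φ.evalEval (q * t x) (q * s x) = 0 := by
    intro x
    rw [hΦ, evalEval_biTaylor, evalEval_dehom, add_comm _ (c.2.1.cast : ℤ_[q]),
      add_comm _ (c.2.2.cast : ℤ_[q])]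
    have h1 := hzF x
    rw [funext (h x), eval_const_mul hF] at h1
    exact (mul_eq_zero.mp h1).resolve_left (pow_ne_zero _ (hε x))
  refine pow_dvd_det_monomials (B := m * r ^ 2) (q : ℤ_[q]) e he (fun x l => (z x l : ℤ_[q]))
    (fun _ => ()) (fun _ => c.1)
    (fun _ => c.2.1.cast) (fun _ => c.2.2.cast) ε s t h
    (fun _ => (Finset.range G ×ˢ Finset.range G).filter fun p => p.1 < a ∨ p.2 < b)
    {()} (fun x => Finset.mem_singleton_self _)
    (fun c' => monomial_mem_monomialSpan_of_evalEval_eq_zero (X := {x : ι // () = c'})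
      (s := fun x => q * s x.1) (t := fun x => q * t x.1) (fun x => dvd_mul_right _ _)
      (fun x => dvd_mul_right _ _) Φ (fun x => hvan x.1) (isUnit_of_toZMod_ne_zero hne) hlow hlex)
    (fun _ _ => (sum_standard_sub_le _ _ _ _).trans (Nat.mul_le_mul_right _ habm.le)) ?_
  simpa using hG

end Padic

lemma exists_dotProduct_eq_zero_or_det_ne_zero {K ι : Type*} [Field K] [Fintype ι] [DecidableEq ι]
    (A : Set (ι → K)) :
    (∃ c : ι → K, c ≠ 0 ∧ ∀ v ∈ A, v ⬝ᵥ c = 0) ∨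
      ∃ M : Matrix ι ι K, (∀ i, M i ∈ A) ∧ M.det ≠ 0 := by
  rcases eq_or_ne (Submodule.span K A) ⊤ with htop | hne
  · right
    obtain ⟨B, hBA, hspan, hB⟩ := exists_linearIndependent K A
    have b := Module.Basis.mk hB (by rw [Subtype.range_coe, hspan, htop])
    obtain ⟨e⟩ : Nonempty (ι ≃ B) := ⟨(Pi.basisFun K ι).indexEquiv b⟩
    refine ⟨Matrix.of fun i => (e i : ι → K), fun i => hBA (e i).2, ?_⟩
    have h : LinearIndependent K (Matrix.of fun i => (e i : ι → K)).row :=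
      hB.comp e e.injective
    rw [Matrix.linearIndependent_rows_iff_isUnit, Matrix.isUnit_iff_isUnit_det] at h
    exact h.ne_zero
  · left
    obtain ⟨φ, hφ, hle⟩ := Submodule.exists_le_ker_of_lt_top _ (lt_top_iff_ne_top.mpr hne)
    refine ⟨fun i => φ (Pi.single i 1), fun h0 => hφ ?_, fun v hv => ?_⟩
    · refine LinearMap.pi_ext' fun i => LinearMap.ext_ring ?_
      simpa using congrFun h0 i
    · have h : φ v = 0 := hle (Submodule.subset_span hv)
      rw [LinearMap.pi_apply_eq_sum_univ] at h
      rw [← h, dotProduct]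
      refine Finset.sum_congr rfl fun i _ => ?_
      rw [smul_eq_mul]
      congr 2
      ext j
      simp [Pi.single_apply, eq_comm]

/-- The exponents of the ternary monomials of degree `d - 1`. -/
noncomputable def ternaryExponent (d : ℕ) (p : Σ i : Fin d, Fin (i + 1)) : Fin 3 →₀ ℕ :=
  Finsupp.equivFunOnFinite.symm ![d - 1 - p.1, p.1 - p.2, p.2]

lemma degree_ternaryExponent (d : ℕ) (p : Σ i : Fin d, Fin (i + 1)) :
    (ternaryExponent d p).degree = d - 1 := by
  have h1 := p.1.2
  have h2 := p.2.2
  rw [Finsupp.degree_eq_sum, Fin.sum_univ_three]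
  simp [ternaryExponent]
  omega

lemma ternaryExponent_injective (d : ℕ) : Function.Injective (ternaryExponent d) := by
  rintro ⟨i, j⟩ ⟨i', j'⟩ h
  have h1 : d - 1 - (i : ℕ) = d - 1 - i' := by simpa [ternaryExponent] using DFunLike.congr_fun h 0
  have h2 : (j : ℕ) = j' := by simpa [ternaryExponent] using DFunLike.congr_fun h 2
  have hi : i = i' := by
    ext
    omega
  subst hi
  congr
  exact Fin.ext h2

lemma two_mul_card_ternaryExponent (d : ℕ) :
    2 * Fintype.card (Σ i : Fin d, Fin (i + 1)) = d * (d + 1) := by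
  simp only [Fintype.card_sigma, Fintype.card_fin]
  rw [Fin.sum_univ_eq_sum_range (fun i => i + 1)]
  induction d with
  | zero => simp
  | succ d ih =>
    rw [Finset.sum_range_succ, mul_add, ih]
    ring

/-- Either some form of degree `d - 1` vanishes on a set of integer vectors, or the set contains
vectors with nonzero interpolation determinant. -/
lemma exists_form_or_det_ne_zero (d : ℕ) (P : Set (Fin 3 → ℤ)) :
    (∃ g : MvPolynomial (Fin 3) ℚ, g ≠ 0 ∧ g.IsHomogeneous (d - 1) ∧
      ∀ z ∈ P, eval (fun l => (z l : ℚ)) g = 0) ∨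
    ∃ z : (Σ i : Fin d, Fin (i + 1)) → Fin 3 → ℤ, (∀ x, z x ∈ P) ∧
      Matrix.det (Matrix.of fun x m => ∏ l, z x l ^ ternaryExponent d m l) ≠ 0 := by
  rcases exists_dotProduct_eq_zero_or_det_ne_zero
    ((fun z : Fin 3 → ℤ => fun m => ∏ l, (z l : ℚ) ^ ternaryExponent d m l) '' P) with
    ⟨c, hc, h⟩ | ⟨M, hM, hdet⟩
  · left
    refine ⟨∑ m, monomial (ternaryExponent d m) (c m), fun h0 => hc ?_, ?_, fun z hz => ?_⟩
    · funext m
      have h1 := congrArg (coeff (ternaryExponent d m)) h0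
      rw [coeff_sum, Finset.sum_eq_single m, coeff_monomial, if_pos rfl, coeff_zero] at h1
      · exact h1
      · intro m' _ hne
        rw [coeff_monomial, if_neg ((ternaryExponent_injective d).ne hne)]
      · simp
    · exact IsHomogeneous.sum _ _ _ fun m _ =>
        isHomogeneous_monomial _ (degree_ternaryExponent d m)
    · rw [map_sum, ← h _ ⟨z, hz, rfl⟩, dotProduct]
      refine Finset.sum_congr rfl fun m _ => ?_
      rw [eval_monomial, Finsupp.prod_fintype _ _ (by simp), mul_comm]
  · right
    choose z hz hzM using hM
    refine ⟨z, hz, fun h0 => hdet ?_⟩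
    have h1 := congrArg (Int.castRingHom ℚ) h0
    rw [RingHom.map_det, map_zero] at h1
    rw [← h1]
    congr 1
    ext x m
    rw [← hzM]
    simp

lemma log_abs_det_le {ι : Type*} [Fintype ι] [DecidableEq ι] [Nonempty ι] {D : ℕ}
    {e : ι → Fin 3 →₀ ℕ} (he : ∀ m, (e m).degree = D) {z : ι → Fin 3 → ℤ} {H : ℝ} (hH : 1 ≤ H)
    (hz : ∀ x l, |(z x l : ℝ)| ≤ H)
    (h0 : Matrix.det (Matrix.of fun x m => ∏ l, z x l ^ e m l) ≠ 0) :
    Real.log |((Matrix.det (Matrix.of fun x m => ∏ l, z x l ^ e m l) : ℤ) : ℝ)| ≤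
      Fintype.card ι * (Real.log (Fintype.card ι) + D * Real.log H) := by
  have hdet : |((Matrix.det (Matrix.of fun x m => ∏ l, z x l ^ e m l) : ℤ) : ℝ)| ≤
      (Fintype.card ι).factorial * (H ^ D) ^ Fintype.card ι := by
    have h1 := RingHom.map_det (Int.castRingHom ℝ) (Matrix.of fun x m => ∏ l, z x l ^ e m l)
    rw [eq_intCast] at h1
    rw [h1]
    have h2 := Matrix.det_le (abv := AbsoluteValue.abs) (x := H ^ D)
      (A := (Int.castRingHom ℝ).mapMatrix (Matrix.of fun x m => ∏ l, z x l ^ e m l)) ?_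
    · simpa [nsmul_eq_mul] using h2
    · intro x m
      simp only [RingHom.mapMatrix_apply, Matrix.map_apply, Matrix.of_apply, eq_intCast,
        AbsoluteValue.abs_apply, Int.cast_prod, Int.cast_pow]
      rw [Finset.abs_prod, ← he m, Finsupp.degree_eq_sum, ← Finset.prod_pow_eq_pow_sum]
      refine Finset.prod_le_prod (fun _ _ => abs_nonneg _) fun l _ => ?_
      rw [abs_pow]
      exact pow_le_pow_left₀ (abs_nonneg _) (hz x l) _
  have hN : (0 : ℝ) < Fintype.card ι := by exact_mod_cast Fintype.card_pos
  have hH0 : 0 < H := by linarith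
  calc _ ≤ Real.log ((Fintype.card ι : ℝ) ^ Fintype.card ι * (H ^ D) ^ Fintype.card ι) := by
        refine Real.log_le_log (abs_pos.mpr (by exact_mod_cast h0)) (hdet.trans ?_)
        gcongr
        exact_mod_cast Nat.factorial_le_pow _
    _ = _ := by
        rw [Real.log_mul (by positivity) (by positivity), Real.log_pow, Real.log_pow, Real.log_pow]
        ring

lemma sum_mul_log_le {A : ℤ} (hA : A ≠ 0) (S : Finset ℕ) (hS : ∀ q ∈ S, q.Prime) (G : ℕ → ℕ)
    (hG : ∀ q ∈ S, (q : ℤ) ^ G q ∣ A) : ∑ q ∈ S, G q * Real.log q ≤ Real.log |(A : ℝ)| := by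
  have hdvd : ∏ q ∈ S, (q : ℤ) ^ G q ∣ A := by
    refine Finset.prod_dvd_of_coprime (fun p hp q hq hpq => ?_) hG
    exact (Nat.isCoprime_iff_coprime.mpr
      ((Nat.coprime_primes (hS p hp) (hS q hq)).mpr hpq)).pow
  have hle := Int.le_of_dvd (abs_pos.mpr hA) ((dvd_abs _ _).mpr hdvd)
  have hpos : ∀ q ∈ S, (0 : ℝ) < (q : ℝ) ^ G q := fun q hq =>
    pow_pos (by exact_mod_cast (hS q hq).pos) _
  calc _ = Real.log (∏ q ∈ S, (q : ℝ) ^ G q) := by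
        rw [Real.log_prod fun q hq => (hpos q hq).ne']
        simp only [Real.log_pow]
    _ ≤ _ := Real.log_le_log (Finset.prod_pos hpos) (by exact_mod_cast hle)

lemma exists_half_le_sum_log_primes (Y : ℕ) :
    ∃ T : ℝ, ∀ x, T ≤ x → x / 2 ≤ ∑ p ∈ Finset.Ioc Y ⌊x⌋₊ with p.Prime, Real.log p := by
  obtain ⟨C, hC⟩ := Chebyshev.psi_sub_theta_le_mul_sqrt
  set B : ℝ := 10 * (|C| + 4 + |Chebyshev.theta Y| + 1) with hB
  have hB0 : 50 ≤ B := by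
    have := abs_nonneg C
    have := abs_nonneg (Chebyshev.theta Y)
    linarith
  refine ⟨B ^ 2 + Y, fun x hx => ?_⟩
  have hY : (0 : ℝ) ≤ Y := Nat.cast_nonneg Y
  have hBx : B ^ 2 ≤ x := by linarith
  have hx1 : 1 ≤ x := by nlinarith
  have hYx : Y ≤ ⌊x⌋₊ := Nat.le_floor (by nlinarith)
  have hsplit : Chebyshev.theta x = Chebyshev.theta Y +
      ∑ p ∈ Finset.Ioc Y ⌊x⌋₊ with p.Prime, Real.log p := by
    rw [Chebyshev.theta, Chebyshev.theta, Nat.floor_natCast, Finset.sum_filter, Finset.sum_filter,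
      Finset.sum_filter, Finset.sum_Ioc_consecutive _ (Nat.zero_le _) hYx]
  have hsq : B ≤ √x := Real.le_sqrt_of_sq_le hBx
  have hss : √x * √x = x := Real.mul_self_sqrt (by linarith)
  have hlog : Real.log (x + 2) ≤ 4 * √x := by
    have h1 : √(x + 2) ≤ 2 * √x := by
      rw [Real.sqrt_le_left (by positivity)]
      nlinarith
    have h2 := Real.log_le_sub_one_of_pos (Real.sqrt_pos.mpr (by linarith : 0 < x + 2))
    rw [Real.log_sqrt (by linarith)] at h2
    linarith
  have h1 := Chebyshev.psi_ge' (x := x) (by linarith)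
  have h2 := hC x
  have h3 : C * √x ≤ |C| * √x := by
    gcongr
    exact le_abs_self C
  have h4 := le_abs_self (Chebyshev.theta Y)
  have h5 : (x - 1) * (0.69 : ℝ) ≤ (x - 1) * Real.log 2 :=
    mul_le_mul_of_nonneg_left (by linarith [Real.log_two_gt_d9]) (by linarith)
  have h6 : |C| + 4 + |Chebyshev.theta Y| + 1 ≤ √x / 10 := by linarith
  have h7 := abs_nonneg (Chebyshev.theta Y)
  have h8 : (|C| + 4 + |Chebyshev.theta Y| + 1) * √x ≤ √x / 10 * √x := by gcongr
  nlinarith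

/-- A criterion for a form of degree `d - 1` to vanish on a set of integer vectors, in terms of the
divisibility of interpolation determinants by primes. -/
lemma exists_form_of_forall_pow_dvd {d r : ℕ} {H : ℝ} (hd : 2 ≤ d) (hH : 1 ≤ H)
    (hdH : (d : ℝ) < H ^ ((3 : ℝ) / 2)) {P : Set (Fin 3 → ℤ)} (hP : ∀ z ∈ P, ∀ l, |(z l : ℝ)| ≤ H)
    (S : Finset ℕ) (hS : ∀ q ∈ S, q.Prime)
    (hdvd : ∀ q ∈ S, ∃ G : ℕ, r * Fintype.card (Σ i : Fin d, Fin (i + 1)) ≤ 2 * G ∧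
      ∀ z : (Σ i : Fin d, Fin (i + 1)) → Fin 3 → ℤ, (∀ x, z x ∈ P) →
        (q : ℤ) ^ G ∣ Matrix.det (Matrix.of fun x m => ∏ l, z x l ^ ternaryExponent d m l))
    (hr : 4 * d * Real.log H < r * ∑ q ∈ S, Real.log q) :
    ∃ g : MvPolynomial (Fin 3) ℚ, g ≠ 0 ∧ g.IsHomogeneous (d - 1) ∧
      ∀ z ∈ P, eval (fun l => (z l : ℚ)) g = 0 := by
  refine (exists_form_or_det_ne_zero d P).resolve_right ?_
  rintro ⟨z, hz, h0⟩
  have : Nonempty (Σ i : Fin d, Fin (i + 1)) := ⟨⟨⟨0, by omega⟩, 0⟩⟩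
  have hcard := two_mul_card_ternaryExponent d
  set N := Fintype.card (Σ i : Fin d, Fin (i + 1)) with hN
  have hN0 : 0 < N := Fintype.card_pos
  have hd' : (2 : ℝ) ≤ d := by exact_mod_cast hd
  have hN0' : (0 : ℝ) < N := by exact_mod_cast hN0
  choose! G hG hdvd using hdvd
  have h1 := sum_mul_log_le h0 S hS G fun q hq => hdvd q hq z hz
  have h2 := log_abs_det_le (degree_ternaryExponent d) hH (fun x => hP _ (hz x)) h0
  rw [← hN] at h2
  have hL : 0 ≤ Real.log H := Real.log_nonneg hH
  have hlogd : Real.log d ≤ 3 / 2 * Real.log H := by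
    rw [← Real.log_rpow (by linarith)]
    exact Real.log_le_log (by linarith) hdH.le
  have hlogN : Real.log N ≤ 3 * Real.log H := by
    have : Real.log N ≤ Real.log ((d : ℝ) ^ 2) := by
      refine Real.log_le_log hN0' ?_
      have : N ≤ d ^ 2 := by nlinarith
      exact_mod_cast this
    rw [Real.log_pow] at this
    push_cast at this
    linarith
  have hD : ((d - 1 : ℕ) : ℝ) = d - 1 := by
    rw [Nat.cast_sub (by omega), Nat.cast_one]
  have h3 : (N : ℝ) * (Real.log N + (d - 1 : ℕ) * Real.log H) ≤ N * (2 * d * Real.log H) := by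
    refine mul_le_mul_of_nonneg_left ?_ hN0'.le
    rw [hD]
    nlinarith
  have h4 : (N : ℝ) * (r * ∑ q ∈ S, Real.log q) ≤ 2 * ∑ q ∈ S, G q * Real.log q := by
    rw [Finset.mul_sum, Finset.mul_sum, Finset.mul_sum]
    refine Finset.sum_le_sum fun q hq => ?_
    have h5 : (r * N : ℝ) ≤ 2 * G q := by exact_mod_cast hG q hq
    have h6 : 0 ≤ Real.log q := Real.log_natCast_nonneg q
    nlinarith
  nlinarith

lemma exists_bad_classes {q : ℕ} [Fact q.Prime] {f : MvPolynomial (Fin 3) ℚ} {d : ℕ} (hf0 : f ≠ 0)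
    (hf : f.IsHomogeneous d) (m : ℕ) :
    ∃ S : Finset (Fin 3 × ZMod q × ZMod q), m * S.card ≤ 6 * d * q ∧
      ∀ c ∉ S, ∀ (r G : ℕ), G + m * r ^ 2 ≤ r * Fintype.card (Σ i : Fin d, Fin (i + 1)) →
        ∀ z : (Σ i : Fin d, Fin (i + 1)) → Fin 3 → ℤ,
          (∀ x, eval (fun l => (z x l : ℚ)) f = 0 ∧ InClass q (z x) c) →
          (q : ℤ) ^ G ∣ Matrix.det (Matrix.of fun x m => ∏ l, z x l ^ ternaryExponent d m l) := by
  obtain ⟨F, hF, hF0, hFz⟩ := exists_padic_form (q := q) hf0 hf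
  refine ⟨highMultiplicity (map PadicInt.toZMod F) m, ?_, fun c hc r G hG z hz => ?_⟩
  · have := mul_card_highMultiplicity_le (hF.map (PadicInt.toZMod (p := q))) hF0 m
    rwa [ZMod.card] at this
  · exact pow_dvd_det_of_notMem_highMultiplicity (degree_ternaryExponent d) hF
      (fun x => hFz _ (hz x).1) hc (fun x => (hz x).2) hG

lemma exists_parameters {L : ℝ} {d : ℕ} (hL : 55488 ≤ L) (hd : L ^ 2 < d) :
    ∃ m r₁ r₂ : ℕ, 4 * m * r₁ ≤ d ^ 2 ∧ d * L ≤ 110976 * r₁ ∧ 17 * d ≤ 2 * L ^ 2 * r₂ ∧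
      ∀ q s : ℕ, (q : ℝ) ≤ L ^ 3 → m * s ≤ 6 * d * q → 4 * s * r₂ ^ 2 ≤ d ^ 2 := by
  have hL0 : 0 < L := by linarith
  have hd0 : (0 : ℝ) < d := by nlinarith
  have half_le_floor : ∀ y : ℝ, 1 ≤ y → y ≤ 2 * (⌊y⌋₊ : ℝ) := by
    intro y hy
    have h1 := Nat.lt_floor_add_one y
    have h2 : (1 : ℝ) ≤ ⌊y⌋₊ := by exact_mod_cast Nat.le_floor (by simpa using hy)
    linarith
  have hm1 : 6936 * (d : ℝ) / L ≤ (⌈6936 * (d : ℝ) / L⌉₊ : ℝ) := Nat.le_ceil _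
  have hm2 : (⌈6936 * (d : ℝ) / L⌉₊ : ℝ) ≤ 2 * (6936 * (d : ℝ) / L) := by
    have h1 := Nat.ceil_lt_add_one (a := 6936 * (d : ℝ) / L) (by positivity)
    have h2 : 1 ≤ 6936 * (d : ℝ) / L := by
      rw [le_div_iff₀ hL0]
      nlinarith
    linarith
  have hr1 := Nat.floor_le (a := (d : ℝ) * L / 55488) (by positivity)
  have hr2 := Nat.floor_le (a := 17 * (d : ℝ) / L ^ 2) (by positivity)
  have hr1' := half_le_floor ((d : ℝ) * L / 55488) (by
    rw [le_div_iff₀ (by norm_num)]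
    nlinarith)
  have hr2' := half_le_floor (17 * (d : ℝ) / L ^ 2) (by
    rw [le_div_iff₀ (by positivity)]
    linarith)
  refine ⟨⌈6936 * (d : ℝ) / L⌉₊, ⌊(d : ℝ) * L / 55488⌋₊, ⌊17 * (d : ℝ) / L ^ 2⌋₊, ?_, ?_, ?_, ?_⟩
  · have : (4 : ℝ) * ⌈6936 * (d : ℝ) / L⌉₊ * ⌊(d : ℝ) * L / 55488⌋₊ ≤ d ^ 2 := by
      calc _ ≤ (4 : ℝ) * (2 * (6936 * (d : ℝ) / L)) * ((d : ℝ) * L / 55488) := by gcongr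
        _ = d ^ 2 := by
          field_simp
          norm_num
    exact_mod_cast this
  · linarith
  · rw [div_le_iff₀ (by positivity)] at hr2'
    linarith
  · intro q s hq hs
    have hs' : (⌈6936 * (d : ℝ) / L⌉₊ : ℝ) * s ≤ 6 * d * q := by exact_mod_cast hs
    have h1 : 6936 * (d : ℝ) / L * s ≤ 6 * d * L ^ 3 := by
      calc _ ≤ (⌈6936 * (d : ℝ) / L⌉₊ : ℝ) * s := by gcongr
        _ ≤ _ := hs'
        _ ≤ _ := by gcongr
    have h2 : 1156 * (s : ℝ) ≤ L ^ 4 := by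
      have : 6936 * (d : ℝ) / L * s = (6 * d / L) * (1156 * s) := by
        field_simp
        ring
      rw [this, show 6 * (d : ℝ) * L ^ 3 = (6 * d / L) * L ^ 4 by field_simp] at h1
      exact le_of_mul_le_mul_left h1 (by positivity)
    have : (4 : ℝ) * s * (⌊17 * (d : ℝ) / L ^ 2⌋₊ : ℝ) ^ 2 ≤ d ^ 2 := by
      calc _ ≤ 4 * s * (17 * (d : ℝ) / L ^ 2) ^ 2 := by gcongr
        _ = 1156 * s * (d ^ 2 / L ^ 4) := by
          field_simp
          ring
        _ ≤ L ^ 4 * (d ^ 2 / L ^ 4) := by gcongr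
        _ = d ^ 2 := by field_simp
    exact_mod_cast this

lemma card_sigma_classes_le {Q : ℕ} (S : Finset ℕ) (hS : S ⊆ Finset.Ioc 0 Q)
    [∀ q : S, NeZero (q : ℕ)] :
    Fintype.card (Option (Σ q : S, Fin 3 × ZMod q × ZMod q)) ≤ 3 * Q ^ 3 + 1 := by
  have hcard : S.card ≤ Q := by simpa using Finset.card_le_card hS
  rw [Fintype.card_option, Fintype.card_sigma]
  refine Nat.succ_le_succ ?_
  calc _ ≤ ∑ _q : S, 3 * Q ^ 2 := by
        refine Finset.sum_le_sum fun q _ => ?_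
        have : (q : ℕ) ≤ Q := (Finset.mem_Ioc.mp (hS q.2)).2
        rw [Fintype.card_prod, Fintype.card_prod, ZMod.card, Fintype.card_fin]
        nlinarith
    _ = S.card * (3 * Q ^ 2) := by simp
    _ ≤ Q * (3 * Q ^ 2) := Nat.mul_le_mul_right _ hcard
    _ = _ := by ring

lemma eval_rep_eq_zero_iff {K : Type*} [Field K] {n d : ℕ} {g : MvPolynomial (Fin n) K}
    (hg : g.IsHomogeneous d) {v : Fin n → K} (hv : v ≠ 0) :
    eval (Projectivization.mk K v hv).rep g = 0 ↔ eval v g = 0 := by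
  set x := Projectivization.mk K v hv with hx
  obtain ⟨a, ha⟩ := (Projectivization.mk_eq_mk_iff' K _ _ x.rep_nonzero hv).mp
    (x.mk_rep.trans hx)
  have ha0 : a ≠ 0 := by
    rintro rfl
    exact x.rep_nonzero (by rw [← ha, zero_smul])
  rw [← ha, show a • v = fun l => a * v l from rfl, eval_const_mul hg, mul_eq_zero,
    or_iff_right (pow_ne_zero _ ha0)]

/-- A finite set of primes such that the integer zeros of a form in each residue class off few
exceptional classes lie on a curve of degree `d - 1`, as do those whose reductions are all
exceptional. -/
lemma exists_forms_of_primes {d : ℕ} {H : ℝ} {f : MvPolynomial (Fin 3) ℚ} (hd : 2 ≤ d)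
    (hH : 1 ≤ H) (hdH : (d : ℝ) < H ^ ((3 : ℝ) / 2)) (hf0 : f ≠ 0) (hf : f.IsHomogeneous d)
    {Q : ℕ} (S : Finset ℕ) (hSQ : S ⊆ Finset.Ioc 0 Q) (hS : ∀ q ∈ S, q.Prime) {m r₁ r₂ : ℕ}
    (hmr : 4 * m * r₁ ≤ d ^ 2)
    (hr₁ : ∀ q ∈ S, 4 * d * Real.log H < r₁ * Real.log q)
    (hr₂ : 4 * d * Real.log H < r₂ * ∑ q ∈ S, Real.log q)
    (hms : ∀ q ∈ S, ∀ s, m * s ≤ 6 * d * q → 4 * s * r₂ ^ 2 ≤ d ^ 2) :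
    ∃ (r : ℕ) (g : Fin r → MvPolynomial (Fin 3) ℚ), r ≤ 3 * Q ^ 3 + 1 ∧
      (∀ i, g i ≠ 0 ∧ (g i).IsHomogeneous (d - 1)) ∧
      ∀ z : Fin 3 → ℤ, eval (fun l => (z l : ℚ)) f = 0 → Finset.univ.gcd z = 1 →
        (∀ l, |(z l : ℝ)| ≤ H) → ∃ i, eval (fun l => (z l : ℚ)) (g i) = 0 := by
  have hprime : ∀ q : S, Fact (q : ℕ).Prime := fun q => ⟨hS q q.2⟩
  have hbad := fun q : S => exists_bad_classes (q := q) hf0 hf m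
  choose B hB hBdvd using hbad
  have hcard := two_mul_card_ternaryExponent d
  set N := Fintype.card (Σ i : Fin d, Fin (i + 1)) with hN
  have hNd : d ^ 2 ≤ 2 * N := by nlinarith
  have hgood : ∀ (q : S) (c : Fin 3 × ZMod q × ZMod q), ∃ g : MvPolynomial (Fin 3) ℚ, g ≠ 0 ∧
      g.IsHomogeneous (d - 1) ∧ (c ∉ B q → ∀ z ∈ {z : Fin 3 → ℤ | (∀ l, |(z l : ℝ)| ≤ H) ∧
        eval (fun l => (z l : ℚ)) f = 0 ∧ InClass q z c}, eval (fun l => (z l : ℚ)) g = 0) := by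
    intro q c
    by_cases hc : c ∈ B q
    · exact ⟨X 0 ^ (d - 1), pow_ne_zero _ (X_ne_zero 0), isHomogeneous_X_pow 0 _,
        fun h => absurd hc h⟩
    suffices ∃ g : MvPolynomial (Fin 3) ℚ, g ≠ 0 ∧ g.IsHomogeneous (d - 1) ∧
        ∀ z ∈ {z : Fin 3 → ℤ | (∀ l, |(z l : ℝ)| ≤ H) ∧
          eval (fun l => (z l : ℚ)) f = 0 ∧ InClass q z c}, eval (fun l => (z l : ℚ)) g = 0 by
      obtain ⟨g, hg0, hg, hgz⟩ := this
      exact ⟨g, hg0, hg, fun _ => hgz⟩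
    refine exists_form_of_forall_pow_dvd (r := r₁) hd hH hdH (fun z hz => hz.1) {(q : ℕ)}
      (fun p hp => Finset.mem_singleton.mp hp ▸ hS q q.2) ?_ (by simpa using hr₁ q q.2)
    intro p hp
    obtain rfl := Finset.mem_singleton.mp hp
    have h1 : 2 * (m * r₁ ^ 2) ≤ r₁ * N := by nlinarith
    rw [← hN]
    refine ⟨r₁ * N - m * r₁ ^ 2, by omega, fun z hz => ?_⟩
    refine hBdvd q c hc r₁ _ ?_ z fun x => (hz x).2
    omega
  have hrest : ∃ g : MvPolynomial (Fin 3) ℚ, g ≠ 0 ∧ g.IsHomogeneous (d - 1) ∧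
      ∀ z ∈ {z : Fin 3 → ℤ | (∀ l, |(z l : ℝ)| ≤ H) ∧ ∀ q : S, ∃ c ∈ B q, InClass q z c},
        eval (fun l => (z l : ℚ)) g = 0 := by
    refine exists_form_of_forall_pow_dvd (r := r₂) hd hH hdH (fun z hz => hz.1) S hS ?_ hr₂
    intro q hq
    have h1 : 2 * ((B ⟨q, hq⟩).card * r₂ ^ 3) ≤ r₂ * N := by
      have := hms q hq _ (hB ⟨q, hq⟩)
      nlinarith
    rw [← hN]
    refine ⟨r₂ * N - (B ⟨q, hq⟩).card * r₂ ^ 3, by omega, fun z hz => ?_⟩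
    have := hprime ⟨q, hq⟩
    exact pow_dvd_det_of_inClass (degree_ternaryExponent d) (r := r₂) (B ⟨q, hq⟩)
      (fun x => (hz x).2 ⟨q, hq⟩)
      (by
        rw [← hN]
        omega)
  choose g hg0 hg hgz using hgood
  obtain ⟨g', hg0', hg', hgz'⟩ := hrest
  let e := Fintype.equivFin (Option (Σ q : S, Fin 3 × ZMod q × ZMod q))
  let h : Option (Σ q : S, Fin 3 × ZMod q × ZMod q) → MvPolynomial (Fin 3) ℚ :=
    fun k => k.elim g' fun p => g p.1 p.2
  refine ⟨_, fun i => h (e.symm i), card_sigma_classes_le S hSQ, fun i => ?_,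
    fun z hz hz1 hzH => ?_⟩
  · change h (e.symm i) ≠ 0 ∧ (h (e.symm i)).IsHomogeneous (d - 1)
    rcases e.symm i with _ | p
    · exact ⟨hg0', hg'⟩
    · exact ⟨hg0 p.1 p.2, hg p.1 p.2⟩
  · suffices ∃ k, eval (fun l => (z l : ℚ)) (h k) = 0 by
      obtain ⟨k, hk⟩ := this
      exact ⟨e k, by simpa using hk⟩
    by_cases hall : ∀ q : S, ∃ c ∈ B q, InClass q z c
    · exact ⟨none, hgz' z ⟨hzH, hall⟩⟩
    · push Not at hall
      obtain ⟨q, hq⟩ := hall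
      obtain ⟨c, hc⟩ := exists_inClass (q := q) hz1
      exact ⟨some ⟨q, c⟩, hgz q c (fun hcB => hq c hcB hc) z ⟨hzH, hz, hc⟩⟩

/-- There are absolute constants `c` and `H₀` such that the following holds.
Let `H ≥ H₀` and let `d` be an integer with `(log H)² < d < H^(3/2)`.  Let
`f ∈ ℚ[x₀,x₁,x₂]` be irreducible homogeneous of degree `d`, defining the plane
curve `C ⊆ ℙ²_ℚ`.  Then there are at most `c·(log H)^12` nonzero homogeneous
polynomials of degree `d − 1` whose joint zero locus contains `C(ℚ,H)`. -/
theorem statement10 :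
    ∃ c H₀ : ℝ, ∀ H : ℝ, H₀ ≤ H → ∀ d : ℕ,
      Real.log H ^ 2 < (d : ℝ) → (d : ℝ) < H ^ ((3 : ℝ) / 2) →
      ∀ f : MvPolynomial (Fin 3) ℚ, Irreducible f → f.IsHomogeneous d →
      ∃ (r : ℕ) (g : Fin r → MvPolynomial (Fin 3) ℚ),
        (r : ℝ) ≤ c * Real.log H ^ 12 ∧
        (∀ i, g i ≠ 0 ∧ (g i).IsHomogeneous (d - 1)) ∧
        ∀ x : Projectivization ℚ (Fin 3 → ℚ),
          eval x.rep f = 0 → qHeightLe x H → ∃ i, eval x.rep (g i) = 0 := by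
  set Y : ℕ := ⌈Real.exp 443904⌉₊ with hY
  obtain ⟨T, hT⟩ := exists_half_le_sum_log_primes Y
  refine ⟨4, Real.exp (max 55488 T), fun H hH d hd hdH f hf0 hf => ?_⟩
  have hH0 : 0 < H := (Real.exp_pos _).trans_le hH
  have hmax : max 55488 T ≤ Real.log H := (Real.le_log_iff_exp_le hH0).mpr hH
  set L := Real.log H with hL
  have hL1 : 55488 ≤ L := (le_max_left _ _).trans hmax
  have hLT : T ≤ L ^ 3 := by
    have : T ≤ L := (le_max_right _ _).trans hmax
    nlinarith [sq_nonneg L]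
  have hH1 : 1 ≤ H := by
    by_contra! h
    have := Real.log_nonpos hH0.le h.le
    linarith
  have hd2 : 2 ≤ d := by
    have : (2 : ℝ) ≤ d := by nlinarith
    exact_mod_cast this
  have hd0 : (0 : ℝ) < d := by exact_mod_cast (by omega : 0 < d)
  obtain ⟨m, r₁, r₂, hmr, hr₁, hr₂, hms⟩ := exists_parameters hL1 hd
  have hsum := hT _ hLT
  set S := (Finset.Ioc Y ⌊L ^ 3⌋₊).filter Nat.Prime with hS
  have hmem : ∀ q ∈ S, (Y < q ∧ q ≤ ⌊L ^ 3⌋₊) ∧ q.Prime := fun q hq => by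
    simpa [hS] using hq
  have hS₁ : ∀ q ∈ S, 4 * d * L < r₁ * Real.log q := by
    intro q hq
    have hlog : 443904 < Real.log q := by
      rw [Real.lt_log_iff_exp_lt (by exact_mod_cast (hmem q hq).2.pos)]
      exact (Nat.le_ceil _).trans_lt (by exact_mod_cast (hmem q hq).1.1)
    have hpos : (0 : ℝ) < r₁ := by
      have : 0 < d * L := by positivity
      linarith
    nlinarith
  have hS₂ : 4 * d * L < r₂ * ∑ q ∈ S, Real.log q := by
    have h1 : (r₂ : ℝ) * (L ^ 3 / 2) ≤ r₂ * ∑ q ∈ S, Real.log q := by gcongr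
    have h2 : 17 * d * L ≤ 2 * L ^ 2 * r₂ * L := by gcongr
    have h3 : 0 < d * L := by positivity
    nlinarith
  obtain ⟨r, g, hr, hg, hgz⟩ := exists_forms_of_primes hd2 hH1 hdH hf0.ne_zero hf
    (Q := ⌊L ^ 3⌋₊) S (fun q hq => Finset.mem_Ioc.mpr ⟨(hmem q hq).2.pos, (hmem q hq).1.2⟩)
    (fun q hq => (hmem q hq).2) hmr hS₁ hS₂
    (fun q hq s => hms q s ((Nat.le_floor_iff (by positivity)).mp (hmem q hq).1.2))
  refine ⟨r, g, ?_, hg, ?_⟩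
  · have h1 : (r : ℝ) ≤ 3 * (⌊L ^ 3⌋₊ : ℝ) ^ 3 + 1 := by exact_mod_cast hr
    have h2 : (⌊L ^ 3⌋₊ : ℝ) ≤ L ^ 3 := Nat.floor_le (by positivity)
    calc (r : ℝ) ≤ 3 * (L ^ 3) ^ 3 + 1 := h1.trans (by gcongr)
      _ = 3 * L ^ 9 + 1 := by ring
      _ ≤ 3 * L ^ 12 + L ^ 12 := by
        gcongr
        · linarith
        · norm_num
        · exact one_le_pow₀ (by linarith)
      _ = 4 * L ^ 12 := by ring
  · rintro x hx ⟨y, ⟨hy, rfl⟩, hgcd, hyH⟩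
    obtain ⟨i, hi⟩ := hgz y ((eval_rep_eq_zero_iff hf hy).mp hx) hgcd hyH
    exact ⟨i, (eval_rep_eq_zero_iff (hg i).2 hy).mpr hi⟩
end
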